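/- arXiv:2406.02712 — 2 statements merged into one kernel-verified Lean document; each statement's English description precedes it below -/
import Mathlib

section
/- Suppose that each U_i is concave and S.S.D. preserving, and that Assumption 1 holds. Then the utility possibility frontier equals the comonotone utility possibility frontier: 𝒰𝒫ℱ = 𝒞𝒰𝒫ℱ. -/
open MeasureTheory ProbabilityTheory Filter

noncomputable section

variable {Ω : Type*} [MeasurableSpace Ω] (μ : MeasureTheory.Measure Ω) [MeasureTheory.IsProbabilityMeasure μ]

/-- The measure is atomless: every set of positive measure has a subset of strictly
smaller positive measure. -/
def AtomlessMeasure : Prop :=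
  ∀ s : Set Ω, MeasurableSet s → μ s ≠ 0 →
    ∃ t ⊆ s, MeasurableSet t ∧ 0 < μ t ∧ μ t < μ s

/-- The space `𝒳 = L^∞` of essentially bounded random variables. -/
abbrev Xinf : Type _ := Lp ℝ ⊤ μ

variable {μ}

/-- Monotone utility functional on `L^∞`. -/
def UMonotone (U : Xinf μ → ℝ) : Prop :=
  ∀ Z₁ Z₂ : Xinf μ, Z₁ ≤ Z₂ → U Z₁ ≤ U Z₂

/-- Translation invariance. -/
def TranslationInvariant (U : Xinf μ → ℝ) : Prop :=
  ∀ (Z : Xinf μ) (c : ℝ), U (Z + Lp.const ⊤ μ c) = U Z + c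

/-- Law invariance. -/
def LawInvariant (U : Xinf μ → ℝ) : Prop :=
  ∀ Z₁ Z₂ : Xinf μ, IdentDistrib (Z₁ : Ω → ℝ) (Z₂ : Ω → ℝ) μ μ → U Z₁ = U Z₂

/-- Positive homogeneity. -/
def PositivelyHomogeneous (U : Xinf μ → ℝ) : Prop :=
  ∀ (Z : Xinf μ) (t : ℝ), 0 ≤ t → U (t • Z) = t * U Z

/-- Concave order `Z₁ ⪯_ccv Z₂`. -/
def ConcaveOrder (Z₁ Z₂ : Xinf μ) : Prop :=
  ∀ φ : ℝ → ℝ, ConcaveOn ℝ Set.univ φ →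
    ∫ ω, φ (Z₁ ω) ∂μ ≤ ∫ ω, φ (Z₂ ω) ∂μ

/-- Strict concave order `Z₁ ≺_ccv Z₂`. -/
def StrictConcaveOrder (Z₁ Z₂ : Xinf μ) : Prop :=
  ConcaveOrder Z₁ Z₂ ∧
    ∀ φ : ℝ → ℝ, StrictConcaveOn ℝ Set.univ φ →
      ∫ ω, φ (Z₁ ω) ∂μ < ∫ ω, φ (Z₂ ω) ∂μ

/-- Increasing concave order `Z₁ ⪯_icv Z₂`. -/
def IncConcaveOrder (Z₁ Z₂ : Xinf μ) : Prop :=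
  ∀ φ : ℝ → ℝ, Monotone φ → ConcaveOn ℝ Set.univ φ →
    ∫ ω, φ (Z₁ ω) ∂μ ≤ ∫ ω, φ (Z₂ ω) ∂μ

/-- Strict increasing concave order `Z₁ ≺_icv Z₂`. -/
def StrictIncConcaveOrder (Z₁ Z₂ : Xinf μ) : Prop :=
  IncConcaveOrder Z₁ Z₂ ∧
    ∀ φ : ℝ → ℝ, Monotone φ → StrictConcaveOn ℝ Set.univ φ →
      ∫ ω, φ (Z₁ ω) ∂μ < ∫ ω, φ (Z₂ ω) ∂μ

/-- Schur concavity. -/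
def SchurConcave (U : Xinf μ → ℝ) : Prop :=
  ∀ Z₁ Z₂ : Xinf μ, ConcaveOrder Z₁ Z₂ → U Z₁ ≤ U Z₂

/-- Strict Schur concavity. -/
def StrictSchurConcave (U : Xinf μ → ℝ) : Prop :=
  ∀ Z₁ Z₂ : Xinf μ, StrictConcaveOrder Z₁ Z₂ → U Z₁ < U Z₂

/-- S.S.D. preserving. -/
def SSDPreserving (U : Xinf μ → ℝ) : Prop :=
  ∀ Z₁ Z₂ : Xinf μ, IncConcaveOrder Z₁ Z₂ → U Z₁ ≤ U Z₂

/-- Strictly S.S.D. preserving. -/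
def StrictSSDPreserving (U : Xinf μ → ℝ) : Prop :=
  ∀ Z₁ Z₂ : Xinf μ, StrictIncConcaveOrder Z₁ Z₂ → U Z₁ < U Z₂

/-- A tuple of (pointwise defined) random variables is comonotone. -/
def ComonotoneFun {n : ℕ} (Z : Fin n → Ω → ℝ) : Prop :=
  ∀ i j ω₁ ω₂, 0 ≤ (Z i ω₁ - Z i ω₂) * (Z j ω₁ - Z j ω₂)

/-- A tuple of elements of `L^∞` is comonotone if some choice of representatives is. -/
def ComonotoneLp {n : ℕ} (Y : Fin n → Xinf μ) : Prop :=
  ∃ Z : Fin n → Ω → ℝ, (∀ i, (Y i : Ω → ℝ) =ᵐ[μ] Z i) ∧ ComonotoneFun Z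

/-- Assumption 1 of the paper. -/
def Assumption1 {n : ℕ} (U : Fin n → Xinf μ → ℝ) : Prop :=
  ∀ i (Z : Xinf μ),
    Continuous (fun c : ℝ => U i (Z + Lp.const ⊤ μ c)) ∧
    StrictMono (fun c : ℝ => U i (Z + Lp.const ⊤ μ c)) ∧
    Tendsto (fun c : ℝ => U i (Z + Lp.const ⊤ μ c)) atTop atTop

section Alloc

variable {n : ℕ} (U : Fin n → Xinf μ → ℝ) (X : Fin n → Xinf μ)

/-- Allocations of the aggregate endowment `∑ i, X i`. -/
def Alloc : Set (Fin n → Xinf μ) := {Y | ∑ i, Y i = ∑ i, X i}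

/-- Individually rational allocations. -/
def IRset : Set (Fin n → Xinf μ) :=
  {Y | Y ∈ Alloc X ∧ ∀ i, U i (X i) ≤ U i (Y i)}

/-- Pareto-optimal allocations. -/
def POset : Set (Fin n → Xinf μ) :=
  {Y | Y ∈ IRset U X ∧ ¬∃ Y' ∈ IRset U X,
    (∀ i, U i (Y i) ≤ U i (Y' i)) ∧ ∃ j, U j (Y j) < U j (Y' j)}

/-- Weakly Pareto-optimal allocations. -/
def WeakPOset : Set (Fin n → Xinf μ) :=
  {Y | Y ∈ IRset U X ∧ ¬∃ Y' ∈ IRset U X, ∀ i, U i (Y i) < U i (Y' i)}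

/-- Comonotone allocations. -/
def AllocC : Set (Fin n → Xinf μ) := {Y | Y ∈ Alloc X ∧ ComonotoneLp Y}

/-- Comonotone Pareto-optimal allocations. -/
def CPOset : Set (Fin n → Xinf μ) :=
  {Y | Y ∈ IRset U X ∧ ComonotoneLp Y ∧ ¬∃ Y' ∈ IRset U X, ComonotoneLp Y' ∧
    (∀ i, U i (Y i) ≤ U i (Y' i)) ∧ ∃ j, U j (Y j) < U j (Y' j)}

/-- Maximizers of the `λ`-weighted sum of utilities over IR allocations. -/
def SmaxSet (lam : Fin n → ℝ) : Set (Fin n → Xinf μ) :=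
  {Y | Y ∈ IRset U X ∧ ∀ Y' ∈ IRset U X,
    ∑ i, lam i * U i (Y' i) ≤ ∑ i, lam i * U i (Y i)}

/-- Maximizers of the `λ`-weighted sum of utilities over IR comonotone allocations. -/
def CSmaxSet (lam : Fin n → ℝ) : Set (Fin n → Xinf μ) :=
  {Y | Y ∈ IRset U X ∧ ComonotoneLp Y ∧ ∀ Y' ∈ IRset U X, ComonotoneLp Y' →
    ∑ i, lam i * U i (Y' i) ≤ ∑ i, lam i * U i (Y i)}

end Alloc



/-- A distortion function: a nondecreasing map of `[0,1]` into `[0,1]` with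
`T 0 = 0` and `T 1 = 1` (encoded as a function on `ℝ`; only values on `[0,1]` matter). -/
def IsDistortion (T : ℝ → ℝ) : Prop :=
  MonotoneOn T (Set.Icc 0 1) ∧ (∀ x ∈ Set.Icc (0:ℝ) 1, T x ∈ Set.Icc (0:ℝ) 1) ∧
    T 0 = 0 ∧ T 1 = 1

/-- A convex distortion function. -/
def IsConvexDistortion (T : ℝ → ℝ) : Prop :=
  IsDistortion T ∧ ConvexOn ℝ (Set.Icc 0 1) T

/-- A concave distortion function. -/
def IsConcaveDistortion (T : ℝ → ℝ) : Prop :=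
  IsDistortion T ∧ ConcaveOn ℝ (Set.Icc 0 1) T

/-- Sequential closedness under pointwise convergence. -/
def SeqClosedPointwise (𝒯 : Set (ℝ → ℝ)) : Prop :=
  ∀ (T : ℕ → ℝ → ℝ) (T' : ℝ → ℝ), (∀ k, T k ∈ 𝒯) →
    (∀ x, Tendsto (fun k => T k x) atTop (nhds (T' x))) → T' ∈ 𝒯

/-- The Choquet integral `∫ Z d(T ∘ μ)` of a random variable `Z` with respect to
the capacity `T ∘ μ`. -/
def choquet (μ : Measure Ω) (T : ℝ → ℝ) (Z : Ω → ℝ) : ℝ :=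
  (∫ t in Set.Ioi (0:ℝ), T (μ {ω | t < Z ω}).toReal) +
    ∫ t in Set.Iio (0:ℝ), (T (μ {ω | t < Z ω}).toReal - 1)

/-- Choquet integral of an element of `L^∞`. -/
def choquetLp (μ : Measure Ω) [IsProbabilityMeasure μ] (T : ℝ → ℝ) (Z : Lp ℝ ⊤ μ) : ℝ :=
  choquet μ T (Z : Ω → ℝ)

/-- The set `𝒢` of tuples of nondecreasing nonnegative functions on `ℝ₊` summing
to the identity. -/
def Gset (n : ℕ) : Set (Fin n → ℝ → ℝ) :=
  {g | (∀ i, MonotoneOn (g i) (Set.Ici 0)) ∧ (∀ i, ∀ x ≥ (0:ℝ), 0 ≤ g i x) ∧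
    ∀ x ≥ (0:ℝ), ∑ i, g i x = x}

/-- A pair of random variables is comonotone. -/
def ComonotonePair (Z S : Ω → ℝ) : Prop :=
  ∀ ω₁ ω₂, 0 ≤ (Z ω₁ - Z ω₂) * (S ω₁ - S ω₂)

def ComonotonePairLp (Z S : Lp ℝ ⊤ μ) : Prop :=
  ∃ Z' S' : Ω → ℝ, (Z : Ω → ℝ) =ᵐ[μ] Z' ∧ (S : Ω → ℝ) =ᵐ[μ] S' ∧ ComonotonePair Z' S'



/-- The essential infimum `s̲` of an element of `L^∞`. -/
def essInfS (S : Lp ℝ ⊤ μ) : ℝ := essInf (S : Ω → ℝ) μ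

/-- The tail probability `ℙ(S > s̲ + x)`. -/
def tailProbS (S : Lp ℝ ⊤ μ) (x : ℝ) : ℝ :=
  (μ {ω | essInfS S + x < S ω}).toReal

/-- The objective `(T_1,…,T_n) ↦ ∫_0^∞ max_i T_i(ℙ(S > s̲ + x)) dx`. -/
def JobjS {n : ℕ} (S : Lp ℝ ⊤ μ) (T : Fin n → ℝ → ℝ) : ℝ :=
  ∫ x in Set.Ioi (0:ℝ), ⨆ i, T i (tailProbS S x)

open Classical in
/-- The set `L_x` of agents attaining the maximum `max_j T_j(ℙ(S > s̲ + x))`. -/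
def Lset {n : ℕ} (S : Lp ℝ ⊤ μ) (T : Fin n → ℝ → ℝ) (x : ℝ) : Finset (Fin n) :=
  Finset.univ.filter (fun i => T i (tailProbS S x) = ⨆ j, T j (tailProbS S x))


/-- Moving two points towards each other increases the sum of the values of a concave function. -/
theorem ConcaveOn.add_le_add_of_transfer {φ : ℝ → ℝ} (hφ : ConcaveOn ℝ Set.univ φ) {a b δ : ℝ}
    (hδ : 0 ≤ δ) (hab : δ < a - b) : φ a + φ b ≤ φ (a - δ) + φ (b + δ) := by
  have hpos : 0 < a - b := hδ.trans_lt hab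
  set t := δ / (a - b) with ht
  have ht0 : 0 ≤ t := by positivity
  have ht1 : t ≤ 1 := (div_le_one hpos).2 hab.le
  have htδ : t * (a - b) = δ := div_mul_cancel₀ _ hpos.ne'
  have h1 := hφ.2 (Set.mem_univ a) (Set.mem_univ b) (sub_nonneg.2 ht1) ht0 (by ring)
  have h2 := hφ.2 (Set.mem_univ a) (Set.mem_univ b) ht0 (sub_nonneg.2 ht1) (by ring)
  simp only [smul_eq_mul] at h1 h2
  rw [show (1 - t) * a + t * b = a - δ by rw [← htδ]; ring] at h1
  rw [show t * a + (1 - t) * b = b + δ by rw [← htδ]; ring] at h2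
  linarith

theorem ConcaveOn.continuous_of_univ {φ : ℝ → ℝ} (hφ : ConcaveOn ℝ Set.univ φ) :
    Continuous φ :=
  continuousOn_univ.1 (hφ.continuousOn isOpen_univ)

/-- Vectors in the box `[-B, B]ⁿ` whose coordinates sum to `s`. -/
def boxSlice (n : ℕ) (B s : ℝ) : Set (Fin n → ℝ) :=
  {y | (∀ i, y i ∈ Set.Icc (-B) B) ∧ ∑ i, y i = s}

theorem isCompact_boxSlice (n : ℕ) (B s : ℝ) : IsCompact (boxSlice n B s) := by
  have h : boxSlice n B s = Set.pi Set.univ (fun _ => Set.Icc (-B) B) ∩ {y | ∑ i, y i = s} := by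
    ext y
    exact and_congr_left fun _ => Set.mem_univ_pi.symm
  rw [h]
  exact (isCompact_univ_pi fun _ => isCompact_Icc).inter_right
    (isClosed_eq (by fun_prop) continuous_const)

theorem boxSlice_nonempty {n : ℕ} (hn : 0 < n) {B s : ℝ}
    (hs : s ∈ Set.Icc (-(n * B)) (n * B)) : (boxSlice n B s).Nonempty := by
  have hn' : (0 : ℝ) < n := by exact_mod_cast hn
  refine ⟨fun _ => s / n, fun _ => ⟨?_, ?_⟩, ?_⟩
  · rw [le_div_iff₀ hn']; linarith [hs.1]
  · rw [div_le_iff₀ hn']; linarith [hs.2]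
  · simp [mul_div_cancel₀ s hn'.ne']

section Welfare

variable {n : ℕ} {κ : Type*} [Fintype κ]

/-- A weighted sum of utilities of individual coordinates with a quadratic penalty. -/
def penalizedWelfare (lam : κ → ℝ) (φ : κ → ℝ → ℝ) (idx : κ → Fin n) (η : ℝ)
    (y : Fin n → ℝ) : ℝ :=
  ∑ k, lam k * φ k (y (idx k)) - η * ∑ i, y i ^ 2

variable {lam : κ → ℝ} {φ : κ → ℝ → ℝ} {idx : κ → Fin n} {η B : ℝ}

theorem continuous_penalizedWelfare (hφ : ∀ k, ConcaveOn ℝ Set.univ (φ k)) :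
    Continuous (penalizedWelfare lam φ idx η) := by
  have := fun k => (hφ k).continuous_of_univ
  unfold penalizedWelfare
  fun_prop

/-- Maximizers of the penalized welfare over slices of the box are monotone in the total. -/
theorem le_of_isMaxOn_penalizedWelfare (hlam : ∀ k, 0 ≤ lam k)
    (hφ : ∀ k, ConcaveOn ℝ Set.univ (φ k)) (hη : 0 < η) {s s' : ℝ} (hs : s ≤ s')
    {y y' : Fin n → ℝ} (hy : y ∈ boxSlice n B s) (hy' : y' ∈ boxSlice n B s')
    (hmax : IsMaxOn (penalizedWelfare lam φ idx η) (boxSlice n B s) y)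
    (hmax' : IsMaxOn (penalizedWelfare lam φ idx η) (boxSlice n B s') y') (i : Fin n) :
    y i ≤ y' i := by
  by_contra! hi
  obtain ⟨j, hj⟩ : ∃ j, y j < y' j := by
    by_contra! h
    have := Finset.sum_lt_sum (s := Finset.univ) (fun k _ => h k) ⟨i, Finset.mem_univ i, hi⟩
    rw [hy.2, hy'.2] at this
    linarith
  have hij : i ≠ j := by rintro rfl; linarith
  set δ := min (y i - y' i) (y' j - y j) / 2 with hδ
  have hmin : 0 < min (y i - y' i) (y' j - y j) := lt_min (by linarith) (by linarith)
  have hδ0 : 0 < δ := by positivity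
  have hδi : δ < y i - y' i := by linarith [min_le_left (y i - y' i) (y' j - y j)]
  have hδj : δ < y' j - y j := by linarith [min_le_right (y i - y' i) (y' j - y j)]
  set d : Fin n → ℝ := fun k => (if k = j then δ else 0) - (if k = i then δ else 0) with hd
  have hdi : d i = -δ := by simp [hd, hij]
  have hdj : d j = δ := by simp [hd, hij.symm]
  have hdk : ∀ k, k ≠ i → k ≠ j → d k = 0 := fun k h1 h2 => by simp [hd, h1, h2]
  have hdsum : ∑ k, d k = 0 := by simp [hd, Finset.sum_sub_distrib]
  have hz : y + d ∈ boxSlice n B s := by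
    refine ⟨fun k => ?_, by simp [Finset.sum_add_distrib, hy.2, hdsum]⟩
    have h1 := hy.1 k
    have h2 := hy'.1 k
    simp only [Set.mem_Icc, Pi.add_apply] at h1 h2 ⊢
    rcases eq_or_ne k i with rfl | hki
    · rw [hdi]; constructor <;> linarith
    rcases eq_or_ne k j with rfl | hkj
    · rw [hdj]; constructor <;> linarith
    · rw [hdk k hki hkj]; constructor <;> linarith
  have hz' : y' - d ∈ boxSlice n B s' := by
    refine ⟨fun k => ?_, by simp [Finset.sum_sub_distrib, hy'.2, hdsum]⟩
    have h1 := hy.1 k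
    have h2 := hy'.1 k
    simp only [Set.mem_Icc, Pi.sub_apply] at h1 h2 ⊢
    rcases eq_or_ne k i with rfl | hki
    · rw [hdi]; constructor <;> linarith
    rcases eq_or_ne k j with rfl | hkj
    · rw [hdj]; constructor <;> linarith
    · rw [hdk k hki hkj]; constructor <;> linarith
  have hconc : ∀ ψ : ℝ → ℝ, ConcaveOn ℝ Set.univ ψ → ∀ k,
      ψ (y k) + ψ (y' k) ≤ ψ ((y + d) k) + ψ ((y' - d) k) := by
    intro ψ hψ k
    simp only [Pi.add_apply, Pi.sub_apply]
    rcases eq_or_ne k i with rfl | hki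
    · have := hψ.add_le_add_of_transfer hδ0.le hδi
      rwa [hdi, ← sub_eq_add_neg, sub_neg_eq_add]
    rcases eq_or_ne k j with rfl | hkj
    · have := hψ.add_le_add_of_transfer hδ0.le hδj
      rw [hdj]; linarith
    · simp [hdk k hki hkj]
  have hquad : ∑ k, ((y + d) k ^ 2 + (y' - d) k ^ 2) < ∑ k, (y k ^ 2 + y' k ^ 2) := by
    refine Finset.sum_lt_sum (fun k _ => ?_) ⟨i, Finset.mem_univ i, ?_⟩
    · simp only [Pi.add_apply, Pi.sub_apply]
      rcases eq_or_ne k i with rfl | hki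
      · rw [hdi]; nlinarith
      rcases eq_or_ne k j with rfl | hkj
      · rw [hdj]; nlinarith
      · simp [hdk k hki hkj]
    · simp only [Pi.add_apply, Pi.sub_apply]
      rw [hdi]; nlinarith
  have hlin : ∑ k, (lam k * φ k (y (idx k)) + lam k * φ k (y' (idx k))) ≤
      ∑ k, (lam k * φ k ((y + d) (idx k)) + lam k * φ k ((y' - d) (idx k))) := by
    refine Finset.sum_le_sum fun k _ => ?_
    rw [← mul_add, ← mul_add]
    exact mul_le_mul_of_nonneg_left (hconc _ (hφ k) _) (hlam k)
  have h1 := isMaxOn_iff.1 hmax _ hz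
  have h2 := isMaxOn_iff.1 hmax' _ hz'
  simp only [penalizedWelfare] at h1 h2
  simp only [Finset.sum_add_distrib] at hquad hlin
  nlinarith [mul_lt_mul_of_pos_left hquad hη]

end Welfare

/-- Continuous comonotone rules that split each total in `[-nB, nB]` into `n` shares
lying in `[-B, B]`. -/
def sharingRules (n : ℕ) (B : ℝ) :
    Set (BoundedContinuousFunction (Set.Icc (-(n * B)) (n * B)) (Fin n → ℝ)) :=
  {f | (∀ x : Set.Icc (-(n * B)) (n * B), f x ∈ boxSlice n B x) ∧
    ∀ x y, x ≤ y → ∀ i, f x i ≤ f y i}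

/-- Monotone shares of a total are `1`-Lipschitz functions of that total. -/
theorem lipschitzWith_one_of_monotone_shares {n : ℕ} {s : Set ℝ} {f : s → Fin n → ℝ}
    (hsum : ∀ x : s, ∑ i, f x i = x) (hmono : ∀ x y : s, x ≤ y → ∀ i, f x i ≤ f y i) :
    LipschitzWith 1 f := by
  have key : ∀ x y : s, x ≤ y → ∀ i, f y i - f x i ≤ (y : ℝ) - x := fun x y hxy i => by
    rw [← hsum x, ← hsum y, ← Finset.sum_sub_distrib]
    exact Finset.single_le_sum (f := fun k => f y k - f x k)
      (fun k _ => sub_nonneg.2 (hmono x y hxy k)) (Finset.mem_univ i)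
  refine LipschitzWith.of_dist_le_mul fun x y => ?_
  rw [NNReal.coe_one, one_mul, dist_pi_le_iff dist_nonneg]
  intro i
  rw [Subtype.dist_eq, Real.dist_eq, Real.dist_eq]
  rcases le_total x y with h | h
  · rw [abs_sub_comm, abs_of_nonneg (sub_nonneg.2 (hmono x y h i)), abs_sub_comm]
    exact (key x y h i).trans (le_abs_self _)
  · rw [abs_of_nonneg (sub_nonneg.2 (hmono y x h i))]
    exact (key y x h i).trans (le_abs_self _)

theorem convex_sharingRules (n : ℕ) (B : ℝ) : Convex ℝ (sharingRules n B) := by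
  intro f hf g hg a b ha hb hab
  refine ⟨fun x => ⟨fun i => ?_, ?_⟩, fun x y hxy i => ?_⟩
  · have := convex_Icc (-B) B ((hf.1 x).1 i) ((hg.1 x).1 i) ha hb hab
    simpa using this
  · simp only [BoundedContinuousFunction.coe_add, BoundedContinuousFunction.coe_smul,
      Pi.add_apply, Pi.smul_apply, smul_eq_mul, Finset.sum_add_distrib, ← Finset.mul_sum,
      (hf.1 x).2, (hg.1 x).2]
    rw [← add_mul, hab, one_mul]
  · simp only [BoundedContinuousFunction.coe_add, BoundedContinuousFunction.coe_smul,
      Pi.add_apply, Pi.smul_apply, smul_eq_mul]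
    gcongr
    · exact hf.2 x y hxy i
    · exact hg.2 x y hxy i

theorem isCompact_sharingRules (n : ℕ) (B : ℝ) : IsCompact (sharingRules n B) := by
  have hev : ∀ x, Continuous fun f : BoundedContinuousFunction
      (Set.Icc (-(n * B)) (n * B)) (Fin n → ℝ) => f x := fun x =>
    (BoundedContinuousFunction.lipschitz_eval_const x).continuous
  refine BoundedContinuousFunction.arzela_ascoli₂ (Set.pi Set.univ fun _ => Set.Icc (-B) B)
    (isCompact_univ_pi fun _ => isCompact_Icc) _ ?_ (fun f x hf i _ => (hf.1 x).1 i) ?_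
  · simp only [sharingRules, Set.ofPred_and, Set.ofPred_forall]
    exact (isClosed_iInter fun x : Set.Icc (-(n * B)) (n * B) =>
        (isCompact_boxSlice n B x).isClosed.preimage (hev x)).inter
      (isClosed_iInter fun x => isClosed_iInter fun y => isClosed_iInter fun _ =>
        isClosed_iInter fun i => isClosed_le ((continuous_apply i).comp (hev x))
          ((continuous_apply i).comp (hev y)))
  · exact (LipschitzWith.uniformEquicontinuous _ 1 fun f =>
      lipschitzWith_one_of_monotone_shares (fun x => (f.2.1 x).2) f.2.2).equicontinuous

/-- Some sharing rule maximizes the penalized welfare at every total. -/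
theorem exists_sharingRule_isMaxOn {n : ℕ} (hn : 0 < n) {κ : Type*} [Fintype κ] {lam : κ → ℝ}
    {φ : κ → ℝ → ℝ} (idx : κ → Fin n) {η : ℝ} (B : ℝ) (hlam : ∀ k, 0 ≤ lam k)
    (hφ : ∀ k, ConcaveOn ℝ Set.univ (φ k)) (hη : 0 < η) :
    ∃ f ∈ sharingRules n B, ∀ x : Set.Icc (-(n * B)) (n * B),
      IsMaxOn (penalizedWelfare lam φ idx η) (boxSlice n B x) (f x) := by
  choose f hf hmax using fun x : Set.Icc (-(n * B)) (n * B) =>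
    (isCompact_boxSlice n B x).exists_isMaxOn (boxSlice_nonempty hn x.2)
      (continuous_penalizedWelfare (lam := lam) (idx := idx) (η := η) hφ).continuousOn
  have hmono : ∀ x y : Set.Icc (-(n * B)) (n * B), x ≤ y → ∀ i, f x i ≤ f y i := fun x y hxy i =>
    le_of_isMaxOn_penalizedWelfare hlam hφ hη hxy (hf x) (hf y) (hmax x) (hmax y) i
  have hcont := (lipschitzWith_one_of_monotone_shares (fun x => (hf x).2) hmono).continuous
  exact ⟨BoundedContinuousFunction.mkOfCompact ⟨f, hcont⟩, ⟨hf, hmono⟩, hmax⟩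

theorem Continuous.exists_abs_le_on_Icc {φ : ℝ → ℝ} (hφ : Continuous φ) (B : ℝ) :
    ∃ C, ∀ x ∈ Set.Icc (-B) B, |φ x| ≤ C :=
  isCompact_Icc.exists_bound_of_continuousOn hφ.continuousOn

theorem integrable_comp_of_mem_Icc {φ : ℝ → ℝ} (hφ : Continuous φ) {B : ℝ} {Z : Ω → ℝ}
    (hZ : AEStronglyMeasurable Z μ) (hB : ∀ᵐ ω ∂μ, Z ω ∈ Set.Icc (-B) B) :
    Integrable (fun ω => φ (Z ω)) μ := by
  obtain ⟨C, hC⟩ := hφ.exists_abs_le_on_Icc B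
  exact Integrable.of_bound (hφ.comp_aestronglyMeasurable hZ) C (hB.mono fun ω h => hC _ h)

section Improvement

variable {n : ℕ} {B : ℝ} {T : Ω → Set.Icc (-(n * B)) (n * B)} {Y : Fin n → Ω → ℝ}

theorem aestronglyMeasurable_sharingRule {μ : Measure Ω} (hT : Measurable T)
    (f : BoundedContinuousFunction (Set.Icc (-(n * B)) (n * B)) (Fin n → ℝ)) (i : Fin n) :
    AEStronglyMeasurable (fun ω => f (T ω) i) μ := by
  have : Continuous fun x => f x i := (continuous_apply i).comp f.continuous
  exact (this.measurable.comp hT).aestronglyMeasurable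

theorem continuousOn_integral_sharingRule (hT : Measurable T) {φ : ℝ → ℝ} (hφ : Continuous φ)
    (i : Fin n) :
    ContinuousOn (fun f : BoundedContinuousFunction (Set.Icc (-(n * B)) (n * B)) (Fin n → ℝ) =>
      ∫ ω, φ (f (T ω) i) ∂μ) (sharingRules n B) := by
  obtain ⟨C, hC⟩ := hφ.exists_abs_le_on_Icc B
  refine continuousOn_of_dominated (bound := fun _ => C)
    (fun f _ => hφ.comp_aestronglyMeasurable (aestronglyMeasurable_sharingRule hT f i))
    (fun f hf => ae_of_all _ fun ω => hC _ ((hf.1 _).1 i)) (integrable_const _)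
    (ae_of_all _ fun ω => Continuous.continuousOn ?_)
  exact hφ.comp ((continuous_apply i).comp
    (BoundedContinuousFunction.lipschitz_eval_const (T ω)).continuous)

/-- Up to an arbitrarily small error, some sharing rule of the total is at least as good as a
given allocation for a finite weighted sum of expected concave utilities. -/
theorem exists_sharingRule_sum_integral_ge (hn : 0 < n) (hT : Measurable T)
    (hY : ∀ i, AEStronglyMeasurable (Y i) μ) (hYB : ∀ᵐ ω ∂μ, (fun i => Y i ω) ∈ boxSlice n B (T ω))
    {κ : Type*} [Fintype κ] {lam : κ → ℝ} {φ : κ → ℝ → ℝ} (idx : κ → Fin n)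
    (hlam : ∀ k, 0 ≤ lam k) (hφ : ∀ k, ConcaveOn ℝ Set.univ (φ k)) {δ : ℝ} (hδ : 0 < δ) :
    ∃ f ∈ sharingRules n B,
      ∑ k, lam k * ∫ ω, φ k (Y (idx k) ω) ∂μ - δ ≤
        ∑ k, lam k * ∫ ω, φ k (f (T ω) (idx k)) ∂μ := by
  have hden : 0 < n * B ^ 2 + 1 := by positivity
  set η := δ / (n * B ^ 2 + 1) with hη
  have hη0 : 0 < η := by positivity
  have hηδ : η * (n * B ^ 2) ≤ δ := by
    have : η * (n * B ^ 2 + 1) = δ := div_mul_cancel₀ _ hden.ne'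
    linarith
  obtain ⟨f, hf, hmax⟩ := exists_sharingRule_isMaxOn hn idx B hlam hφ hη0
  refine ⟨f, hf, ?_⟩
  have hYi : ∀ k, Integrable (fun ω => lam k * φ k (Y (idx k) ω)) μ := fun k =>
    (integrable_comp_of_mem_Icc (hφ k).continuous_of_univ (hY _)
      (hYB.mono fun ω h => h.1 _)).const_mul _
  have hfi : ∀ k, Integrable (fun ω => lam k * φ k (f (T ω) (idx k))) μ := fun k =>
    (integrable_comp_of_mem_Icc (hφ k).continuous_of_univ
      (aestronglyMeasurable_sharingRule hT f _)
      (ae_of_all _ fun ω => (hf.1 (T ω)).1 _)).const_mul _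
  simp only [← integral_const_mul]
  rw [← integral_finsetSum _ fun k _ => hYi k, ← integral_finsetSum _ fun k _ => hfi k,
    sub_le_iff_le_add]
  have hadd : ∫ ω, (∑ k, lam k * φ k (f (T ω) (idx k)) + δ) ∂μ =
      ∫ ω, ∑ k, lam k * φ k (f (T ω) (idx k)) ∂μ + δ := by
    rw [integral_add (integrable_finsetSum _ fun k _ => hfi k) (integrable_const _)]
    simp
  rw [← hadd]
  refine integral_mono_ae (integrable_finsetSum _ fun k _ => hYi k)
    ((integrable_finsetSum _ fun k _ => hfi k).add (integrable_const _)) ?_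
  filter_upwards [hYB] with ω hω
  have h1 := isMaxOn_iff.1 (hmax (T ω)) _ hω
  simp only [penalizedWelfare] at h1
  have h2 : ∑ i, Y i ω ^ 2 ≤ n * B ^ 2 := by
    have : ∑ i, Y i ω ^ 2 ≤ ∑ _i : Fin n, B ^ 2 :=
      Finset.sum_le_sum fun i _ => sq_le_sq' (hω.1 i).1 (hω.1 i).2
    simpa using this
  have h3 : 0 ≤ η * ∑ i, f (T ω) i ^ 2 := by positivity
  have h4 := mul_le_mul_of_nonneg_left h2 hη0.le
  linarith

theorem concaveOn_integral_sharingRule (hT : Measurable T) {φ : ℝ → ℝ}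
    (hφ : ConcaveOn ℝ Set.univ φ) (i : Fin n) :
    ConcaveOn ℝ (sharingRules n B) (fun f => ∫ ω, φ (f (T ω) i) ∂μ) := by
  have hint : ∀ f ∈ sharingRules n B, Integrable (fun ω => φ (f (T ω) i)) μ := fun f hf =>
    integrable_comp_of_mem_Icc hφ.continuous_of_univ (aestronglyMeasurable_sharingRule hT f i)
      (ae_of_all _ fun ω => (hf.1 (T ω)).1 i)
  refine ⟨convex_sharingRules n B, fun f hf g hg a b ha hb hab => ?_⟩
  simp only [smul_eq_mul]
  rw [← integral_const_mul, ← integral_const_mul,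
    ← integral_add ((hint f hf).const_mul a) ((hint g hg).const_mul b)]
  refine integral_mono (((hint f hf).const_mul a).add ((hint g hg).const_mul b))
    (hint _ (convex_sharingRules n B hf hg ha hb hab)) fun ω => ?_
  exact hφ.2 (Set.mem_univ (f (T ω) i)) (Set.mem_univ (g (T ω) i)) ha hb hab

/-- Up to arbitrarily small errors, some sharing rule of the total improves upon a given
allocation for finitely many expected concave utilities simultaneously. -/
theorem exists_sharingRule_forall_integral_ge (hn : 0 < n) (hT : Measurable T)
    (hY : ∀ i, AEStronglyMeasurable (Y i) μ) (hYB : ∀ᵐ ω ∂μ, (fun i => Y i ω) ∈ boxSlice n B (T ω))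
    {κ : Type*} [Fintype κ] {φ : κ → ℝ → ℝ} (idx : κ → Fin n)
    (hφ : ∀ k, ConcaveOn ℝ Set.univ (φ k)) {ε : κ → ℝ} (hε : ∀ k, 0 < ε k) :
    ∃ f ∈ sharingRules n B, ∀ k,
      ∫ ω, φ k (Y (idx k) ω) ∂μ - ε k ≤ ∫ ω, φ k (f (T ω) (idx k)) ∂μ := by
  classical
  by_contra! hcon
  set c : κ → ℝ := fun k => ∫ ω, φ k (Y (idx k) ω) ∂μ with hc
  set F := fun (f : BoundedContinuousFunction (Set.Icc (-(n * B)) (n * B)) (Fin n → ℝ)) (k : κ) =>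
    ∫ ω, φ k (f (T ω) (idx k)) ∂μ with hF
  have hconvC : Convex ℝ {v : κ → ℝ | ∃ f ∈ sharingRules n B, ∀ k, v k ≤ F f k - c k} := by
    rintro v ⟨f, hf, hv⟩ w ⟨g, hg, hw⟩ a b ha hb hab
    refine ⟨a • f + b • g, convex_sharingRules n B hf hg ha hb hab, fun k => ?_⟩
    have h1 : a • F f k + b • F g k ≤ F (a • f + b • g) k :=
      (concaveOn_integral_sharingRule hT (hφ k) (idx k)).2 hf hg ha hb hab
    have h2 := mul_le_mul_of_nonneg_left (hv k) ha
    have h3 := mul_le_mul_of_nonneg_left (hw k) hb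
    simp only [smul_eq_mul, Pi.add_apply, Pi.smul_apply] at h1 ⊢
    have h4 : c k = a * c k + b * c k := by rw [← add_mul, hab, one_mul]
    linarith
  have hD : {v : κ → ℝ | ∀ k, -ε k < v k} = Set.pi Set.univ fun k => Set.Ioi (-ε k) := by
    ext v; simp
  have hconvD : Convex ℝ {v : κ → ℝ | ∀ k, -ε k < v k} := by
    rw [hD]; exact convex_pi fun k _ => convex_Ioi _
  have hopenD : IsOpen {v : κ → ℝ | ∀ k, -ε k < v k} := by
    rw [hD]; exact isOpen_set_pi Set.finite_univ fun k _ => isOpen_Ioi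
  have hdisj : Disjoint {v : κ → ℝ | ∀ k, -ε k < v k}
      {v : κ → ℝ | ∃ f ∈ sharingRules n B, ∀ k, v k ≤ F f k - c k} := by
    rw [Set.disjoint_left]
    rintro v hv ⟨f, hf, hvf⟩
    obtain ⟨k, hk⟩ := hcon f hf
    have := hv k
    have := hvf k
    simp only [hF, hc] at this
    linarith
  obtain ⟨L, r, hLD, hLC⟩ := geometric_hahn_banach_open hconvD hopenD hconvC hdisj
  have hr : 0 < r := by simpa using hLD 0 fun k => by simpa using hε k
  set e : κ → κ → ℝ := fun k j => if k = j then 1 else 0 with he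
  have hLe : ∀ k, L (e k) ≤ 0 := by
    intro k
    by_contra! hpos
    have hmem : ∀ j, -ε j < ((r / L (e k)) • e k) j := fun j => by
      have : 0 ≤ ((r / L (e k)) • e k) j := by
        simp only [Pi.smul_apply, smul_eq_mul, he]
        split_ifs <;> positivity
      linarith [hε j]
    have := hLD _ hmem
    rw [map_smul, smul_eq_mul, div_mul_cancel₀ _ hpos.ne'] at this
    exact lt_irrefl _ this
  obtain ⟨f, hf, hfδ⟩ := exists_sharingRule_sum_integral_ge hn hT hY hYB idx
    (fun k => neg_nonneg.2 (hLe k)) hφ (half_pos hr)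
  have h1 := hLC (fun k => F f k - c k) ⟨f, hf, fun k => le_rfl⟩
  have h2 : L (fun k => F f k - c k) = ∑ k, (F f k - c k) * L (e k) :=
    LinearMap.pi_apply_eq_sum_univ (L : (κ → ℝ) →ₗ[ℝ] ℝ) _
  rw [h2] at h1
  simp only [sub_mul, Finset.sum_sub_distrib] at h1
  simp only [neg_mul, Finset.sum_neg_distrib, mul_comm (L (e _))] at hfδ
  simp only [hF, hc] at h1
  linarith

/-- Some sharing rule of the total improves upon a given allocation for all expected concave
utilities simultaneously. -/
theorem exists_sharingRule_forall_concave_integral_ge (hn : 0 < n) (hT : Measurable T)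
    (hY : ∀ i, AEStronglyMeasurable (Y i) μ)
    (hYB : ∀ᵐ ω ∂μ, (fun i => Y i ω) ∈ boxSlice n B (T ω)) :
    ∃ f ∈ sharingRules n B, ∀ i, ∀ φ : ℝ → ℝ, ConcaveOn ℝ Set.univ φ →
      ∫ ω, φ (Y i ω) ∂μ ≤ ∫ ω, φ (f (T ω) i) ∂μ := by
  let ι := Fin n × {φ : ℝ → ℝ // ConcaveOn ℝ Set.univ φ} × {ε : ℝ // 0 < ε}
  let A : ι → Set (BoundedContinuousFunction (Set.Icc (-(n * B)) (n * B)) (Fin n → ℝ)) :=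
    fun p => sharingRules n B ∩ (fun f => ∫ ω, p.2.1.1 (f (T ω) p.1) ∂μ) ⁻¹'
      Set.Ici (∫ ω, p.2.1.1 (Y p.1 ω) ∂μ - p.2.2.1)
  obtain ⟨f, hf, hfA⟩ := (isCompact_sharingRules n B).inter_iInter_nonempty A
    (fun p => (continuousOn_integral_sharingRule hT p.2.1.2.continuous_of_univ
      p.1).preimage_isClosed_of_isClosed (isCompact_sharingRules n B).isClosed isClosed_Ici)
    (fun u => by
      obtain ⟨f, hf, hfu⟩ := exists_sharingRule_forall_integral_ge hn hT hY hYB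
        (κ := u) (φ := fun p => p.1.2.1.1) (fun p => p.1.1) (fun p => p.1.2.1.2)
        (ε := fun p => p.1.2.2.1) (fun p => p.1.2.2.2)
      exact ⟨f, hf, Set.mem_iInter₂.2 fun p hp => ⟨hf, hfu ⟨p, hp⟩⟩⟩)
  refine ⟨f, hf, fun i φ hφ => le_of_forall_pos_le_add fun ε hε => ?_⟩
  exact sub_le_iff_le_add.1 (Set.mem_iInter.1 hfA (i, ⟨φ, hφ⟩, ⟨ε, hε⟩)).2

end Improvement

theorem Lp_coeFn_sum {μ : Measure Ω} {n : ℕ} (Y : Fin n → Xinf μ) :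
    ((∑ i, Y i : Xinf μ) : Ω → ℝ) =ᵐ[μ] fun ω => ∑ i, Y i ω := by
  induction n with
  | zero =>
    simp only [Finset.univ_eq_empty, Finset.sum_empty]
    exact Lp.coeFn_zero ℝ ⊤ μ
  | succ n ih =>
    simp only [Fin.sum_univ_succ]
    filter_upwards [Lp.coeFn_add (Y 0) (∑ i : Fin n, Y i.succ), ih fun i => Y i.succ] with ω h1 h2
    rw [h1, Pi.add_apply, h2]

theorem Xinf_exists_bound {μ : Measure Ω} (Z : Xinf μ) : ∃ C, ∀ᵐ ω ∂μ, |Z ω| ≤ C := by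
  have hfin := Lp.eLpNorm_lt_top Z
  rw [eLpNorm_exponent_top] at hfin
  refine ⟨(eLpNormEssSup Z μ).toReal, ?_⟩
  filter_upwards [ae_le_eLpNormEssSup (f := Z) (μ := μ)] with ω hω
  have := ENNReal.toReal_mono hfin.ne hω
  simpa using this

/-- **Comonotone improvement**: every allocation is dominated, in the concave order for each
agent, by a comonotone allocation of the same aggregate endowment. -/
theorem exists_comonotone_improvement {n : ℕ} (hn : 0 < n) (Y : Fin n → Xinf μ) :
    ∃ Z : Fin n → Xinf μ, ∑ i, Z i = ∑ i, Y i ∧ ComonotoneLp Z ∧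
      ∀ i, ConcaveOrder (Y i) (Z i) := by
  choose C hC using fun i => Xinf_exists_bound (Y i)
  set B := ∑ i, |C i| with hB
  have hB0 : 0 ≤ B := Finset.sum_nonneg fun i _ => abs_nonneg _
  have hCB : ∀ i, C i ≤ B := fun i => (le_abs_self _).trans
    (Finset.single_le_sum (f := fun i => |C i|) (fun i _ => abs_nonneg _) (Finset.mem_univ i))
  have hbox : -(n * B) ≤ n * B := by
    have : 0 ≤ n * B := by positivity
    linarith
  set S : Ω → ℝ := ((∑ i, Y i : Xinf μ) : Ω → ℝ) with hS
  set T : Ω → Set.Icc (-(n * B)) (n * B) := fun ω => Set.projIcc _ _ hbox (S ω) with hTdef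
  have hT : Measurable T :=
    continuous_projIcc.measurable.comp (Lp.stronglyMeasurable _).measurable
  have hYbd : ∀ᵐ ω ∂μ, ∀ i, Y i ω ∈ Set.Icc (-B) B := by
    rw [ae_all_iff]
    exact fun i => (hC i).mono fun ω h => abs_le.1 (h.trans (hCB i))
  have hTS : ∀ᵐ ω ∂μ, (T ω : ℝ) = S ω ∧ S ω = ∑ i, Y i ω := by
    filter_upwards [hYbd, Lp_coeFn_sum Y] with ω h1 h2
    refine ⟨?_, h2⟩
    have hmem : S ω ∈ Set.Icc (-(n * B)) (n * B) := by
      rw [hS, h2]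
      constructor
      · have := Finset.sum_le_sum fun i (_ : i ∈ Finset.univ) => (h1 i).1
        simpa using this
      · have := Finset.sum_le_sum fun i (_ : i ∈ Finset.univ) => (h1 i).2
        simpa using this
    simp [hTdef, Set.projIcc_of_mem hbox hmem]
  obtain ⟨f, hf, hfφ⟩ := exists_sharingRule_forall_concave_integral_ge (μ := μ) hn hT
    (Y := fun i => Y i) (fun i => (Lp.stronglyMeasurable (Y i)).aestronglyMeasurable) (by
      filter_upwards [hYbd, hTS] with ω h1 h2
      exact ⟨h1, by rw [h2.1, h2.2]⟩)
  have hmem : ∀ i, MemLp (fun ω => f (T ω) i) ⊤ μ := fun i =>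
    MemLp.of_bound (aestronglyMeasurable_sharingRule hT f i) B
      (ae_of_all _ fun ω => abs_le.2 ((hf.1 (T ω)).1 i))
  refine ⟨fun i => (hmem i).toLp _, ?_,
    ⟨fun i ω => f (T ω) i, fun i => (hmem i).coeFn_toLp, ?_⟩, ?_⟩
  · refine Lp.ext ?_
    have hall : ∀ᵐ ω ∂μ, ∀ i, (hmem i).toLp _ ω = f (T ω) i :=
      ae_all_iff.2 fun i => (hmem i).coeFn_toLp
    filter_upwards [Lp_coeFn_sum fun i => (hmem i).toLp _, hall, hTS] with ω h1 h2 h3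
    rw [h1, ← hS, ← h3.1, ← (hf.1 (T ω)).2]
    exact Finset.sum_congr rfl fun i _ => h2 i
  · intro i j ω₁ ω₂
    rcases le_total (T ω₁) (T ω₂) with h | h
    · exact mul_nonneg_of_nonpos_of_nonpos (sub_nonpos.2 (hf.2 _ _ h i))
        (sub_nonpos.2 (hf.2 _ _ h j))
    · exact mul_nonneg (sub_nonneg.2 (hf.2 _ _ h i)) (sub_nonneg.2 (hf.2 _ _ h j))
  · intro i φ hφ
    refine (hfφ i φ hφ).trans_eq (integral_congr_ae ?_)
    filter_upwards [(hmem i).coeFn_toLp] with ω hω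
    rw [hω]

/-- If each `U i` is concave and S.S.D. preserving and Assumption 1 holds, the
utility possibility frontier coincides with the comonotone utility possibility frontier. -/
theorem UPF_eq_CUPF
    (hatomless : AtomlessMeasure μ) {n : ℕ} (hn : 0 < n)
    (U : Fin n → Xinf μ → ℝ) (X : Fin n → Xinf μ)
    (hA1 : Assumption1 U)
    (hconc : ∀ i, ConcaveOn ℝ Set.univ (U i)) (hSSD : ∀ i, SSDPreserving (U i)) :
    {u : Fin n → ℝ | ∃ Y ∈ POset U X, ∀ i, u i = U i (Y i)} =
      {u : Fin n → ℝ | ∃ Y ∈ CPOset U X, ∀ i, u i = U i (Y i)} := by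
  have himp : ∀ Y ∈ IRset U X, ∃ Z ∈ IRset U X, ComonotoneLp Z ∧ ∀ i, U i (Y i) ≤ U i (Z i) := by
    intro Y hY
    obtain ⟨Z, hZ, hcom, hle⟩ := exists_comonotone_improvement hn Y
    have hU : ∀ i, U i (Y i) ≤ U i (Z i) := fun i => hSSD i _ _ fun φ _ hφ => hle i φ hφ
    exact ⟨Z, ⟨hZ.trans hY.1, fun i => (hY.2 i).trans (hU i)⟩, hcom, hU⟩
  ext u
  constructor
  · rintro ⟨Y, ⟨hY, hmax⟩, hu⟩
    obtain ⟨Z, hZ, hcom, hle⟩ := himp Y hY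
    refine ⟨Z, ⟨hZ, hcom, ?_⟩, fun i => ?_⟩
    · rintro ⟨Y', hY', -, h1, j, hj⟩
      exact hmax ⟨Y', hY', fun i => (hle i).trans (h1 i), j, (hle j).trans_lt hj⟩
    · rw [hu i]
      exact (hle i).eq_or_lt.resolve_right fun h => hmax ⟨Z, hZ, hle, i, h⟩
  · rintro ⟨Y, ⟨hY, -, hmax⟩, hu⟩
    refine ⟨Y, ⟨hY, ?_⟩, hu⟩
    rintro ⟨Y', hY', h1, j, hj⟩
    obtain ⟨Z, hZ, hcom, hle⟩ := himp Y' hY'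
    exact hmax ⟨Z, hZ, hcom, fun i => (h1 i).trans (hle i), j, hj.trans_le (hle j)⟩

end
end

section
/- A monetary utility U : 𝒳 → ℝ is S.S.D. preserving if and only if it is law-invariant. -/
open MeasureTheory ProbabilityTheory Filter

noncomputable section

variable {Ω : Type*} [MeasurableSpace Ω] (μ : MeasureTheory.Measure Ω) [MeasureTheory.IsProbabilityMeasure μ]

variable {μ}

lemma AtomlessMeasure.exists_subset_measureReal_le (h : AtomlessMeasure μ) {s : Set Ω}
    (hs : MeasurableSet s) (hpos : 0 < μ.real s) {ε : ℝ} (hε : 0 < ε) :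
    ∃ t ⊆ s, MeasurableSet t ∧ 0 < μ.real t ∧ μ.real t ≤ ε := by
  have key : ∀ n : ℕ, ∃ t ⊆ s, MeasurableSet t ∧ 0 < μ.real t ∧ μ.real t ≤ (1 / 2) ^ n := by
    intro n
    induction n with
    | zero => exact ⟨s, subset_rfl, hs, hpos, by simp⟩
    | succ n ih =>
      obtain ⟨t, hts, ht, ht0, htn⟩ := ih
      obtain ⟨u, hut, hu, hu0, hu1⟩ := h t ht (fun h0 => by simp [Measure.real, h0] at ht0)
      have hu0' : 0 < μ.real u := ENNReal.toReal_pos hu0.ne' (measure_ne_top _ _)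
      have hu1' : μ.real u < μ.real t := (ENNReal.toReal_lt_toReal (measure_ne_top _ _)
        (measure_ne_top _ _)).2 hu1
      have hd : μ.real (t \ u) = μ.real t - μ.real u := measureReal_sdiff hut hu
      rw [pow_succ]
      rcases le_total (μ.real u) (μ.real (t \ u)) with hc | hc
      · exact ⟨u, hut.trans hts, hu, hu0', by linarith⟩
      · exact ⟨t \ u, Set.sdiff_subset.trans hts, ht.diff hu, by linarith, by linarith⟩
  obtain ⟨n, hn⟩ := exists_pow_lt_of_lt_one hε (by norm_num : (1 / 2 : ℝ) < 1)
  obtain ⟨t, h1, h2, h3, h4⟩ := key n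
  exact ⟨t, h1, h2, h3, h4.trans hn.le⟩

/-- Sierpiński: the restriction of an atomless measure to a set takes every
intermediate value. -/
lemma AtomlessMeasure.exists_subset_measureReal_eq (h : AtomlessMeasure μ) {s : Set Ω}
    (hs : MeasurableSet s) {w : ℝ} (hw : 0 ≤ w) (hws : w ≤ μ.real s) :
    ∃ t ⊆ s, MeasurableSet t ∧ μ.real t = w := by
  let P := {A : Set Ω // MeasurableSet A ∧ A ⊆ s ∧ μ.real A ≤ w}
  have step : ∀ A : P, ∃ A' : P, A.1 ⊆ A'.1 ∧ ∀ C, MeasurableSet C → C ⊆ s \ A.1 →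
      μ.real A.1 + μ.real C ≤ w → μ.real C ≤ 2 * (μ.real A'.1 - μ.real A.1) := by
    rintro ⟨A, hA, hAs, hAw⟩
    let T : Set ℝ := {r | ∃ C, MeasurableSet C ∧ C ⊆ s \ A ∧ μ.real A + μ.real C ≤ w ∧ μ.real C = r}
    have hT0 : (0 : ℝ) ∈ T := ⟨∅, MeasurableSet.empty, Set.empty_subset _, by simpa using hAw, by simp⟩
    have hTb : BddAbove T := ⟨1, by rintro _ ⟨C, -, -, -, rfl⟩; exact measureReal_le_one⟩
    have hsup : ∃ r ∈ T, sSup T ≤ 2 * r := by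
      rcases (le_csSup hTb hT0).eq_or_lt with h0 | h0
      · exact ⟨0, hT0, by linarith⟩
      · obtain ⟨r, hr, hr'⟩ := exists_lt_of_lt_csSup ⟨0, hT0⟩ (half_lt_self h0)
        exact ⟨r, hr, by linarith⟩
    obtain ⟨_, ⟨B, hB, hBs, hBw, rfl⟩, hBT⟩ := hsup
    have hdisj : Disjoint A B := Set.disjoint_left.2 fun x hx hx' => (hBs hx').2 hx
    have hun : μ.real (A ∪ B) = μ.real A + μ.real B := measureReal_union hdisj hB
    refine ⟨⟨A ∪ B, hA.union hB, Set.union_subset hAs (hBs.trans Set.sdiff_subset),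
      by rw [hun]; exact hBw⟩, Set.subset_union_left, fun C hC hCs hCw => ?_⟩
    have := le_csSup hTb (show μ.real C ∈ T from ⟨C, hC, hCs, hCw, rfl⟩)
    simp only [hun]
    linarith
  choose next hsub hnext using step
  let A : ℕ → P := fun n => next^[n] ⟨∅, MeasurableSet.empty, Set.empty_subset _, by simpa using hw⟩
  have hAsucc : ∀ n, A (n + 1) = next (A n) := fun n => Function.iterate_succ_apply' _ _ _
  have hmono : Monotone fun n => (A n).1 := monotone_nat_of_le_succ fun n => by
    simp only [hAsucc]; exact hsub _
  have hlim : Tendsto (fun n => μ.real (A n).1) atTop (nhds (μ.real (⋃ n, (A n).1))) :=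
    (ENNReal.tendsto_toReal (measure_ne_top _ _)).comp (tendsto_measure_iUnion_atTop hmono)
  have hmeas : MeasurableSet (⋃ n, (A n).1) := MeasurableSet.iUnion fun n => (A n).2.1
  have hle : μ.real (⋃ n, (A n).1) ≤ w := le_of_tendsto' hlim fun n => (A n).2.2.2
  have hss : (⋃ n, (A n).1) ⊆ s := Set.iUnion_subset fun n => (A n).2.2.1
  refine ⟨_, hss, hmeas, le_antisymm hle (le_of_not_gt fun hlt => ?_)⟩
  have hdiff : μ.real (s \ ⋃ n, (A n).1) = μ.real s - μ.real (⋃ n, (A n).1) :=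
    measureReal_sdiff hss hmeas
  obtain ⟨C, hCs, hC, hC0, hCw⟩ := h.exists_subset_measureReal_le (hs.diff hmeas)
    (by rw [hdiff]; linarith) (sub_pos.2 hlt)
  have hbound : ∀ n, μ.real C ≤ 2 * (μ.real (A (n + 1)).1 - μ.real (A n).1) := by
    intro n
    rw [hAsucc]
    refine hnext _ C hC (hCs.trans (Set.sdiff_subset_sdiff_right (Set.subset_iUnion (fun n => (A n).1) n))) ?_
    have : μ.real (A n).1 ≤ μ.real (⋃ n, (A n).1) :=
      measureReal_mono (Set.subset_iUnion (fun n => (A n).1) n)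
    linarith
  have hzero : Tendsto (fun n => 2 * (μ.real (A (n + 1)).1 - μ.real (A n).1)) atTop (nhds 0) := by
    simpa using ((hlim.comp (tendsto_add_atTop_nat 1)).sub hlim).const_mul 2
  exact absurd (ge_of_tendsto' hzero hbound) (not_le.2 hC0)

/-- A set carries a piece of prescribed measure on which `Z` lies below its values on the rest. -/
lemma AtomlessMeasure.exists_lower_subset (h : AtomlessMeasure μ) {s : Set Ω}
    (hs : MeasurableSet s) {Z : Ω → ℝ} (hZ : Measurable Z) {m M : ℝ}
    (hb : ∀ ω ∈ s, m ≤ Z ω ∧ Z ω ≤ M) {w : ℝ} (hw : 0 < w) (hws : w ≤ μ.real s) :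
    ∃ t ⊆ s, MeasurableSet t ∧ μ.real t = w ∧ ∃ c, m ≤ c ∧ c ≤ M ∧
      (∀ ω ∈ t, Z ω ≤ c) ∧ ∀ ω ∈ s \ t, c ≤ Z ω := by
  let F : ℝ → ℝ := fun x => μ.real (s ∩ {ω | Z ω ≤ x})
  let Q : Set ℝ := {x | w ≤ F x}
  have hMQ : M ∈ Q := by
    have : s ∩ {ω | Z ω ≤ M} = s := Set.inter_eq_left.2 fun ω hω => (hb ω hω).2
    simpa [Q, F, this] using hws
  have hQm : ∀ x ∈ Q, m ≤ x := by
    intro x hx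
    by_contra hlt
    have : s ∩ {ω | Z ω ≤ x} = ∅ := by
      ext ω
      simp only [Set.mem_inter_iff, Set.mem_ofPred_eq, Set.mem_empty_iff_false, iff_false, not_and]
      intro hω
      linarith [(hb ω hω).1, not_le.1 hlt]
    simp only [Q, F, Set.mem_ofPred_eq, this, measureReal_empty] at hx
    linarith
  have hQb : BddBelow Q := ⟨m, hQm⟩
  set c := sInf Q with hc
  have hle : ∀ x, MeasurableSet {ω | Z ω ≤ x} := fun x => measurableSet_le hZ measurable_const
  have hlt : MeasurableSet {ω | Z ω < c} := measurableSet_lt hZ measurable_const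
  obtain ⟨u, hua, hu, hul⟩ := exists_seq_strictAnti_tendsto c
  obtain ⟨v, hva, hv, hvl⟩ := exists_seq_strictMono_tendsto c
  have hup : w ≤ μ.real (s ∩ {ω | Z ω ≤ c}) := by
    have heq : s ∩ {ω | Z ω ≤ c} = ⋂ n, s ∩ {ω | Z ω ≤ u n} := by
      ext ω
      simp only [Set.mem_inter_iff, Set.mem_ofPred_eq, Set.mem_iInter]
      refine ⟨fun hω n => ⟨hω.1, hω.2.trans (hu n).le⟩, fun hω => ⟨(hω 0).1, ?_⟩⟩
      exact ge_of_tendsto' hul fun n => (hω n).2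
    have hlim : Tendsto (fun n => μ.real (s ∩ {ω | Z ω ≤ u n})) atTop
        (nhds (μ.real (s ∩ {ω | Z ω ≤ c}))) := by
      rw [heq]
      refine (ENNReal.tendsto_toReal (measure_ne_top _ _)).comp
        (tendsto_measure_iInter_atTop (fun n => (hs.inter (hle _)).nullMeasurableSet) ?_
          ⟨0, measure_ne_top _ _⟩)
      exact fun i j hij ω hω => ⟨hω.1, le_trans hω.2 (hua.antitone hij)⟩
    refine ge_of_tendsto' hlim fun n => ?_
    obtain ⟨x, hx, hxu⟩ := exists_lt_of_csInf_lt ⟨M, hMQ⟩ (hu n)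
    exact le_trans hx (measureReal_mono fun ω hω => ⟨hω.1, le_trans hω.2 hxu.le⟩)
  have hlow : μ.real (s ∩ {ω | Z ω < c}) ≤ w := by
    have heq : s ∩ {ω | Z ω < c} = ⋃ n, s ∩ {ω | Z ω ≤ v n} := by
      ext ω
      simp only [Set.mem_inter_iff, Set.mem_ofPred_eq, Set.mem_iUnion]
      constructor
      · rintro ⟨h1, h2⟩
        obtain ⟨n, hn⟩ := (hvl.eventually (lt_mem_nhds h2)).exists
        exact ⟨n, h1, hn.le⟩
      · rintro ⟨n, h1, h2⟩
        exact ⟨h1, h2.trans_lt (hv n)⟩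
    have hlim : Tendsto (fun n => μ.real (s ∩ {ω | Z ω ≤ v n})) atTop
        (nhds (μ.real (s ∩ {ω | Z ω < c}))) := by
      rw [heq]
      refine (ENNReal.tendsto_toReal (measure_ne_top _ _)).comp (tendsto_measure_iUnion_atTop ?_)
      exact fun i j hij ω hω => ⟨hω.1, le_trans hω.2 (hva.monotone hij)⟩
    refine le_of_tendsto' hlim fun n => ?_
    by_contra hcon
    exact absurd (csInf_le hQb (show v n ∈ Q from (not_le.1 hcon).le)) (not_le.2 (hv n))
  have hsub : s ∩ {ω | Z ω < c} ⊆ s ∩ {ω | Z ω ≤ c} := fun ω hω => ⟨hω.1, (show Z ω < c from hω.2).le⟩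
  have hd := measureReal_sdiff (μ := μ) hsub (hs.inter hlt)
  obtain ⟨t, ht, htm, htw⟩ := h.exists_subset_measureReal_eq
    ((hs.inter (hle c)).diff (hs.inter hlt)) (sub_nonneg.2 hlow) (by rw [hd]; linarith)
  refine ⟨(s ∩ {ω | Z ω < c}) ∪ t, Set.union_subset Set.inter_subset_left
    fun ω hω => (ht hω).1.1, (hs.inter hlt).union htm, ?_, c, le_csInf ⟨M, hMQ⟩ hQm,
    csInf_le hQb hMQ, ?_, ?_⟩
  · rw [measureReal_union (Set.disjoint_left.2 fun ω hω hω' => (ht hω').2 hω) htm, htw]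
    ring
  · rintro ω (hω | hω)
    · exact le_of_lt hω.2
    · exact (ht hω).1.2
  · rintro ω ⟨hω, hω'⟩
    by_contra hcon
    exact hω' (Or.inl ⟨hω, not_le.1 hcon⟩)

/-- A bounded random variable can be cut into `n` pieces of equal measure, arranged in increasing
order and separated by the levels `q 0 ≤ q 1 ≤ …`. -/
lemma AtomlessMeasure.exists_quantile_pieces (h : AtomlessMeasure μ) {Z : Ω → ℝ}
    (hZ : Measurable Z) {m w : ℝ} (hw : 0 < w) {n : ℕ} (hn : 1 ≤ n) :
    ∀ {s : Set Ω} {M : ℝ}, MeasurableSet s → m ≤ M → (∀ ω ∈ s, m ≤ Z ω ∧ Z ω ≤ M) →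
      μ.real s = n * w →
      ∃ (g : Ω → ℕ) (q : ℕ → ℝ), Measurable g ∧ q 0 = m ∧ q n = M ∧ (∀ k, m ≤ q k ∧ q k ≤ M) ∧
        (∀ k < n, μ.real (s ∩ g ⁻¹' {k}) = w) ∧
        ∀ ω ∈ s, g ω < n ∧ q (g ω) ≤ Z ω ∧ Z ω ≤ q (g ω + 1) := by
  classical
  induction n, hn using Nat.le_induction with
  | base =>
    intro s M hs hmM hb hsw
    refine ⟨fun _ => 0, fun k => if k = 0 then m else M, measurable_const, by simp, by simp,
      fun k => ?_, fun k hk => ?_, fun ω hω => by simpa using hb ω hω⟩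
    · dsimp only; split_ifs <;> simp [hmM]
    · obtain rfl : k = 0 := by omega
      simpa using hsw
  | succ n hn ih =>
    intro s M hs hmM hb hsw
    have hn' : (0 : ℝ) < n := by exact_mod_cast hn
    push_cast at hsw
    obtain ⟨t, hts, ht, htw, c, hmc, hcM, hlow, hup⟩ :=
      h.exists_lower_subset hs hZ hb (mul_pos hn' hw) (by rw [hsw]; nlinarith)
    obtain ⟨g, q, hg, hq0, hqn, hqb, hgw, hgq⟩ :=
      ih ht hmc (fun ω hω => ⟨(hb ω (hts hω)).1, hlow ω hω⟩) htw
    have hd : μ.real (s \ t) = w := by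
      rw [measureReal_sdiff hts ht, htw, hsw]; ring
    refine ⟨t.piecewise g fun _ => n, fun k => if k ≤ n then q k else M,
      Measurable.piecewise ht hg measurable_const, by simpa using hq0, by simp, fun k => ?_,
      fun k hk => ?_, fun ω hω => ?_⟩
    · dsimp only
      split_ifs
      · exact ⟨(hqb k).1, (hqb k).2.trans hcM⟩
      · exact ⟨hmM, le_rfl⟩
    · rcases Nat.lt_succ_iff_lt_or_eq.1 hk with hk | rfl
      · rw [← hgw k hk]
        congr 1
        ext ω
        by_cases hω : ω ∈ t
        · simp [hω, hts hω]
        · simp [hω, hk.ne']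
      · rw [← hd]
        congr 1
        ext ω
        by_cases hω : ω ∈ t
        · simp [hω, (hgq ω hω).1.ne]
        · simp [hω]
    · by_cases hωt : ω ∈ t
      · obtain ⟨h1, h2, h3⟩ := hgq ω hωt
        simp only [Set.piecewise_eq_of_mem _ _ _ hωt]
        rw [if_pos h1.le, if_pos (by omega)]
        exact ⟨by omega, h2, h3⟩
      · simp only [Set.piecewise_eq_of_notMem _ _ _ hωt]
        simpa [hqn] using ⟨hup ω ⟨hω, hωt⟩, (hb ω hω).2⟩

lemma mul_sum_range_le_sum_range_mul {c x : ℕ → ℝ} (hc : Antitone c) {N : ℕ}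
    (hx : ∀ k ≤ N, 0 ≤ ∑ i ∈ Finset.range k, x i) :
    ∀ n ≤ N, c n * ∑ i ∈ Finset.range n, x i ≤ ∑ i ∈ Finset.range n, c i * x i := by
  intro n
  induction n with
  | zero => simp
  | succ n ih =>
    intro hn
    have h1 := ih (by omega)
    have h2 := mul_le_mul_of_nonneg_right (hc n.le_succ) (hx (n + 1) hn)
    rw [Finset.sum_range_succ] at h2 ⊢
    rw [Finset.sum_range_succ]
    refine h2.trans ?_
    rw [mul_add]
    linarith

lemma sum_mul_le_of_monotone_of_antitone {N : ℕ} {a b c : Fin N → ℝ} (ha : Monotone a)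
    (hc : Antitone c) (hc0 : ∀ k, 0 ≤ c k)
    (hab : ∀ t, ∑ i, min (a i) t ≤ ∑ i, min (b i) t) :
    ∑ i, c i * a i ≤ ∑ i, c i * b i := by
  let e : (Fin N → ℝ) → ℕ → ℝ := fun f i => if h : i < N then f ⟨i, h⟩ else 0
  have he : ∀ (f : Fin N → ℝ) (i : Fin N), e f i = f i := fun f i => by simp [e]
  have hec : Antitone (e c) := by
    intro i j hij
    by_cases hj : j < N
    · simpa [e, hj, hij.trans_lt hj] using hc (show (⟨i, hij.trans_lt hj⟩ : Fin N) ≤ ⟨j, hj⟩ from hij)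
    · by_cases hi : i < N
      · simpa [e, hj, hi] using hc0 _
      · simp [e, hj, hi]
  have hx : ∀ k ≤ N, 0 ≤ ∑ i ∈ Finset.range k, (e b i - e a i) := by
    rintro (_ | j) hj
    · simp
    have hjN : j < N := hj
    set t := a ⟨j, hjN⟩
    have key : ∀ i : Fin N, min (b i) t - min (a i) t ≤ if (i : ℕ) < j + 1 then b i - a i else 0 := by
      intro i
      split_ifs with hi
      · have : a i ≤ t := ha (show i ≤ ⟨j, hjN⟩ from Nat.lt_succ_iff.1 hi)
        rw [min_eq_left this]
        linarith [min_le_left (b i) t]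
      · have : t ≤ a i := ha (show (⟨j, hjN⟩ : Fin N) ≤ i from by
          rw [Fin.le_def]; dsimp only; omega)
        rw [min_eq_right this]
        linarith [min_le_right (b i) t]
    have h1 := Finset.sum_le_sum fun i (_ : i ∈ Finset.univ) => key i
    rw [Finset.sum_sub_distrib] at h1
    have h2 : ∑ i : Fin N, (if (i : ℕ) < j + 1 then b i - a i else 0) =
        ∑ i ∈ Finset.range (j + 1), (e b i - e a i) := by
      calc _ = ∑ i : Fin N, (fun i : ℕ => if i < j + 1 then e b i - e a i else 0) i := by
            simp only [he]
        _ = ∑ i ∈ Finset.range N, if i < j + 1 then e b i - e a i else 0 :=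
            Fin.sum_univ_eq_sum_range (fun i => if i < j + 1 then e b i - e a i else 0) N
        _ = _ := by
            rw [← Finset.sum_filter]
            congr 1
            ext i
            simp only [Finset.mem_filter, Finset.mem_range]
            omega
    linarith [hab t]
  have h := mul_sum_range_le_sum_range_mul hec hx N le_rfl
  have hN : e c N = 0 := by simp [e]
  rw [hN, zero_mul, ← Fin.sum_univ_eq_sum_range (fun i => e c i * (e b i - e a i))] at h
  simp only [he, mul_sub, Finset.sum_sub_distrib] at h
  linarith

/-- If `∑ min (a i) t ≤ ∑ min (b i) t` for all `t` and `c` is nonnegative, then some permutation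
of `a` pairs with `c` below `b`. -/
lemma exists_perm_sum_mul_le {N : ℕ} {a b c : Fin N → ℝ} (hc : ∀ k, 0 ≤ c k)
    (hab : ∀ t, ∑ i, min (a i) t ≤ ∑ i, min (b i) t) :
    ∃ σ : Equiv.Perm (Fin N), ∑ i, c i * a (σ i) ≤ ∑ i, c i * b i := by
  let τ := Tuple.sort fun i => -c i
  let ρ := Tuple.sort a
  have hτ : Antitone (c ∘ τ) := fun i j hij => by
    simpa [τ] using Tuple.monotone_sort (fun i => -c i) hij
  refine ⟨τ.symm.trans ρ, ?_⟩
  rw [← Equiv.sum_comp τ fun i => c i * a ((τ.symm.trans ρ) i),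
    ← Equiv.sum_comp τ fun i => c i * b i]
  simp only [Equiv.trans_apply, Equiv.symm_apply_apply]
  refine sum_mul_le_of_monotone_of_antitone (Tuple.monotone_sort a) hτ (fun k => hc _) fun t => ?_
  rw [Equiv.sum_comp τ fun i => min (b i) t]
  have := Equiv.sum_comp ρ fun i => min (a i) t
  exact this.le.trans (hab t)

/-- Weak majorization: a monotone concave function on `ℝ^N` whose values at all rearrangements of
`a` are at least `v` is at least `v` at `b`. -/
lemma ConcaveOn.le_of_sum_min_le {N : ℕ} {f : (Fin N → ℝ) → ℝ} (hf : ConcaveOn ℝ Set.univ f)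
    (hmono : Monotone f) {a b : Fin N → ℝ} {v : ℝ}
    (hv : ∀ σ : Equiv.Perm (Fin N), v ≤ f (a ∘ σ))
    (hab : ∀ t, ∑ i, min (a i) t ≤ ∑ i, min (b i) t) : v ≤ f b := by
  by_contra hb
  have hcont : Continuous f := hf.locallyLipschitz.continuous
  have hconv : Convex ℝ {x | v ≤ f x} := by simpa using hf.convex_ge v
  obtain ⟨L, u, hLb, hLu⟩ := geometric_hahn_banach_point_closed hconv
    (isClosed_le continuous_const hcont) hb
  have hL : ∀ x, L x = ∑ i, L (Pi.single i 1) * x i := by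
    intro x
    conv_lhs => rw [← Finset.univ_sum_single x]
    rw [map_sum]
    refine Finset.sum_congr rfl fun i _ => ?_
    rw [mul_comm, ← smul_eq_mul, ← map_smul]
    congr 1
    ext j
    by_cases h : j = i
    · subst h; simp
    · simp [h]
  have hc : ∀ k, 0 ≤ L (Pi.single k 1) := by
    intro k
    by_contra hneg
    push Not at hneg
    have hmem : ∀ s : ℝ, 0 ≤ s → u < L a + s * L (Pi.single k 1) := by
      intro s hs
      have : v ≤ f (a + s • Pi.single k 1) := (hv 1).trans (hmono fun i => by
        by_cases h : i = k
        · subst h; simpa using hs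
        · simp [h])
      simpa using hLu _ this
    have h0 := hmem 0 le_rfl
    have := hmem ((L a - u) / -L (Pi.single k 1)) (div_nonneg (by linarith) (by linarith))
    rw [div_mul_eq_mul_div, mul_div_assoc, div_neg, div_self hneg.ne] at this
    linarith
  obtain ⟨σ, hσ⟩ := exists_perm_sum_mul_le hc hab
  have h1 := hLu _ (hv σ)
  rw [hL] at h1 hLb
  simp only [Function.comp] at h1
  linarith

/-- The quantile cutting of a bounded random variable into `N` pieces of measure `1 / N`. -/
structure IsQuantileCut (μ : Measure Ω) (Z : Ω → ℝ) (m M : ℝ) {N : ℕ} (g : Ω → Fin N)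
    (q : ℕ → ℝ) : Prop where
  measurable : Measurable g
  zero : q 0 = m
  last : q N = M
  mem : ∀ k, m ≤ q k ∧ q k ≤ M
  measure : ∀ k, μ.real (g ⁻¹' {k}) = 1 / N
  le : ∀ ω, q (g ω) ≤ Z ω ∧ Z ω ≤ q (g ω + 1)

lemma AtomlessMeasure.exists_isQuantileCut (h : AtomlessMeasure μ) {Z : Ω → ℝ}
    (hZ : Measurable Z) {m M : ℝ} (hmM : m ≤ M) (hb : ∀ ω, m ≤ Z ω ∧ Z ω ≤ M) {N : ℕ}
    (hN : 1 ≤ N) : ∃ (g : Ω → Fin N) (q : ℕ → ℝ), IsQuantileCut μ Z m M g q := by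
  have hN' : (0 : ℝ) < N := by exact_mod_cast hN
  obtain ⟨g, q, hg, hq0, hqN, hqb, hgw, hgq⟩ :=
    h.exists_quantile_pieces hZ (one_div_pos.2 hN') hN MeasurableSet.univ hmM
      (fun ω _ => hb ω) (by simp [hN'.ne'])
  have hpre : ∀ k : Fin N, (fun ω => (⟨g ω, (hgq ω trivial).1⟩ : Fin N)) ⁻¹' {k} =
      g ⁻¹' {(k : ℕ)} := fun k => by ext ω; simp [Fin.ext_iff]
  refine ⟨fun ω => ⟨g ω, (hgq ω trivial).1⟩, q, measurable_to_countable' fun k => ?_, hq0, hqN,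
    hqb, fun k => ?_, fun ω => (hgq ω trivial).2⟩
  · rw [hpre]; exact hg (measurableSet_singleton _)
  · rw [hpre]; simpa using hgw k k.2

lemma integral_comp_eq_average {N : ℕ} {g : Ω → Fin N} (hg : Measurable g)
    (hgw : ∀ k, μ.real (g ⁻¹' {k}) = 1 / N) (ψ : Fin N → ℝ) :
    ∫ ω, ψ (g ω) ∂μ = 1 / N * ∑ k, ψ k := by
  have := Measure.isProbabilityMeasure_map hg.aemeasurable (μ := μ)
  rw [← integral_map (φ := g) (f := ψ) hg.aemeasurable (by fun_prop),
    integral_fintype (Integrable.of_finite), Finset.mul_sum]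
  refine Finset.sum_congr rfl fun k _ => ?_
  rw [map_measureReal_apply hg (measurableSet_singleton _), hgw, smul_eq_mul]

lemma IsQuantileCut.average_le {Z : Ω → ℝ} {m M : ℝ} {N : ℕ} {g : Ω → Fin N} {q : ℕ → ℝ}
    (h : IsQuantileCut μ Z m M g q) {φ : ℝ → ℝ} (hφ : Monotone φ)
    (hint : Integrable (fun ω => φ (Z ω)) μ) :
    1 / N * ∑ k : Fin N, φ (q (k + 1)) ≤ ∫ ω, φ (Z ω) ∂μ + 1 / N * (φ M - φ m) ∧
      ∫ ω, φ (Z ω) ∂μ - 1 / N * (φ M - φ m) ≤ 1 / N * ∑ k : Fin N, φ (q k) := by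
  have htel : ∑ k : Fin N, φ (q (k + 1)) = ∑ k : Fin N, φ (q k) + (φ M - φ m) := by
    rw [← h.last, ← h.zero, ← Finset.sum_range_sub fun k => φ (q k),
      Fin.sum_univ_eq_sum_range fun k => φ (q (k + 1)), Fin.sum_univ_eq_sum_range fun k => φ (q k),
      ← Finset.sum_add_distrib]
    simp
  have hfin : ∀ ψ : Fin N → ℝ, Integrable (fun ω => ψ (g ω)) μ := fun ψ =>
    Integrable.of_bound ((by fun_prop : Measurable ψ).comp h.measurable).aestronglyMeasurable ‖ψ‖
      (ae_of_all _ fun ω => norm_le_pi_norm ψ _)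
  have h1 := integral_comp_eq_average h.measurable h.measure fun k => φ (q k)
  have h2 := integral_comp_eq_average h.measurable h.measure fun k => φ (q (k + 1))
  have h3 : ∫ ω, φ (q (g ω)) ∂μ ≤ ∫ ω, φ (Z ω) ∂μ :=
    integral_mono (hfin fun k => φ (q k)) hint fun ω => hφ (h.le ω).1
  have h4 : ∫ ω, φ (Z ω) ∂μ ≤ ∫ ω, φ (q (g ω + 1)) ∂μ :=
    integral_mono hint (hfin fun k => φ (q (k + 1))) fun ω => hφ (h.le ω).2
  rw [htel, mul_add] at *
  constructor <;> linarith

lemma integrable_min_const {X : Ω → ℝ} (hX : Integrable X μ) (t : ℝ) :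
    Integrable (fun ω => min (X ω) t) μ := hX.inf (integrable_const t)

lemma sum_min_le_of_isQuantileCut {X Y : Ω → ℝ} (hX : Measurable X) (hY : Measurable Y)
    {m M : ℝ} (hmM : m < M) (hXb : ∀ ω, m ≤ X ω ∧ X ω ≤ M) (hYb : ∀ ω, m ≤ Y ω ∧ Y ω ≤ M)
    {δ : ℝ} (hδ : 0 < δ) (hδM : δ ≤ M - m) {N : ℕ} (hN : 1 ≤ N)
    (hNp : 2 / N ≤ δ / (M - m) * μ.real {ω | X ω ≤ m}) {g g' : Ω → Fin N} {q r : ℕ → ℝ}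
    (hq : IsQuantileCut μ X m M g q) (hr : IsQuantileCut μ Y m M g' r) {t : ℝ}
    (hXY : ∫ ω, min (X ω) t ∂μ ≤ ∫ ω, min (Y ω) t ∂μ) :
    ∑ k : Fin N, min (q (k + 1)) t ≤ ∑ k : Fin N, min (r k + δ) t := by
  have hN' : (0 : ℝ) < N := by exact_mod_cast hN
  set φ : ℝ → ℝ := fun x => min x t with hφ
  have hφm : Monotone φ := fun x y hxy => min_le_min_right t hxy
  have hXi := integrable_min_const (Integrable.of_mem_Icc m M hX.aemeasurable
    (ae_of_all μ fun ω => hXb ω)) t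
  have hYi := integrable_min_const (Integrable.of_mem_Icc m M hY.aemeasurable
    (ae_of_all μ fun ω => hYb ω)) t
  have hA := (hq.average_le hφm hXi).1
  have hB := (hr.average_le hφm hYi).2
  set O := φ M - φ m with hO
  have hO0 : 0 ≤ O := sub_nonneg.2 (hφm hmM.le)
  set θ := δ / (M - m) with hθ
  have hMm : 0 < M - m := sub_pos.2 hmM
  have hθ0 : 0 ≤ θ := by positivity
  have hθ1 : θ ≤ 1 := (div_le_one hMm).2 hδM
  have hpt : ∀ k : Fin N, (1 - θ) * φ (r k) + θ * φ M ≤ φ (r k + δ) := by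
    intro k
    refine le_min ?_ ?_
    · have h1 : φ (r k) ≤ r k := min_le_left _ _
      have h2 : φ M ≤ M := min_le_left _ _
      have h3 : θ * (M - r k) ≤ θ * (M - m) :=
        mul_le_mul_of_nonneg_left (by linarith [(hr.mem k).1]) hθ0
      have h4 : θ * (M - m) = δ := div_mul_cancel₀ _ hMm.ne'
      nlinarith
    · have h1 : φ (r k) ≤ t := min_le_right _ _
      have h2 : φ M ≤ t := min_le_right _ _
      nlinarith
  have hC : (1 - θ) * (1 / N * ∑ k : Fin N, φ (r k)) + θ * φ M ≤
      1 / N * ∑ k : Fin N, φ (r k + δ) := by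
    have := Finset.sum_le_sum fun k (_ : k ∈ Finset.univ) => hpt k
    rw [Finset.sum_add_distrib, ← Finset.mul_sum] at this
    simp only [Finset.sum_const, Finset.card_univ, Fintype.card_fin, nsmul_eq_mul] at this
    have := mul_le_mul_of_nonneg_left this (one_div_pos.2 hN').le
    refine le_trans (le_of_eq ?_) this
    field_simp
  have hE : ∫ ω, φ (X ω) ∂μ ≤ φ M - μ.real {ω | X ω ≤ m} * O := by
    have hms : MeasurableSet {ω | X ω ≤ m} := measurableSet_le hX measurable_const
    have hind : Integrable ({ω | X ω ≤ m}.indicator fun _ => O) μ :=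
      (integrable_const O).indicator hms
    have hle : ∫ ω, φ (X ω) ∂μ ≤ ∫ ω, (φ M - {ω | X ω ≤ m}.indicator (fun _ => O) ω) ∂μ := by
      refine integral_mono hXi ((integrable_const _).sub hind) fun ω => ?_
      by_cases hω : X ω ≤ m
      · rw [Set.indicator_of_mem (show ω ∈ {ω | X ω ≤ m} from hω), hO, sub_sub_cancel]
        exact hφm hω
      · rw [Set.indicator_of_notMem (show ω ∉ {ω | X ω ≤ m} from hω), sub_zero]
        exact hφm (hXb ω).2
    rwa [integral_sub (integrable_const _) hind, integral_indicator_const _ hms,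
      integral_const, smul_eq_mul, probReal_univ, smul_eq_mul, one_mul] at hle
  have hkey : 2 / N * O ≤ θ * (μ.real {ω | X ω ≤ m} * O) := by
    rw [← mul_assoc]; exact mul_le_mul_of_nonneg_right hNp hO0
  have hfin : 1 / N * ∑ k : Fin N, φ (q (k + 1)) ≤ 1 / N * ∑ k : Fin N, φ (r k + δ) := by
    have e1 := mul_le_mul_of_nonneg_left hE hθ0
    have e2 := mul_le_mul_of_nonneg_left (hB.trans' (sub_le_sub_right hXY _)) (sub_nonneg.2 hθ1)
    have e3 : 0 ≤ θ * (1 / N * O) := by positivity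
    have e4 : 2 / (N : ℝ) * O = 2 * (1 / N * O) := by ring
    simp only [hφ] at *
    nlinarith
  exact le_of_mul_le_mul_left hfin (one_div_pos.2 hN')

/-- The element of `L^∞` with value `x k` on the piece `g ⁻¹' {k}`. -/
def stepLp (μ : Measure Ω) [IsProbabilityMeasure μ] {N : ℕ} {g : Ω → Fin N} (hg : Measurable g)
    (x : Fin N → ℝ) : Xinf μ :=
  (memLp_top_of_bound ((by fun_prop : Measurable x).comp hg).aestronglyMeasurable ‖x‖
    (ae_of_all _ fun ω => norm_le_pi_norm x (g ω)) : MemLp (x ∘ g) ⊤ μ).toLp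

lemma coeFn_stepLp {N : ℕ} {g : Ω → Fin N} (hg : Measurable g) (x : Fin N → ℝ) :
    stepLp μ hg x =ᵐ[μ] x ∘ g := MemLp.coeFn_toLp _

lemma monotone_stepLp {N : ℕ} {g : Ω → Fin N} (hg : Measurable g) : Monotone (stepLp μ hg) := by
  intro x y hxy
  rw [← Lp.coeFn_le]
  filter_upwards [coeFn_stepLp (μ := μ) hg x, coeFn_stepLp (μ := μ) hg y] with ω h1 h2
  rw [h1, h2]
  exact hxy _

lemma stepLp_add_const {N : ℕ} {g : Ω → Fin N} (hg : Measurable g) (x : Fin N → ℝ) (c : ℝ) :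
    stepLp μ hg (fun k => x k + c) = stepLp μ hg x + Lp.const ⊤ μ c := rfl

lemma concaveOn_comp_stepLp {U : Xinf μ → ℝ} (hU : ConcaveOn ℝ Set.univ U) {N : ℕ}
    {g : Ω → Fin N} (hg : Measurable g) :
    ConcaveOn ℝ Set.univ fun x : Fin N → ℝ => U (stepLp μ hg x) :=
  ⟨convex_univ, fun x _ y _ _ _ ha hb hab =>
    hU.2 (Set.mem_univ (stepLp μ hg x)) (Set.mem_univ (stepLp μ hg y)) ha hb hab⟩

lemma identDistrib_stepLp {N : ℕ} {g g' : Ω → Fin N} (hg : Measurable g) (hg' : Measurable g')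
    (hgw : ∀ k, μ.real (g ⁻¹' {k}) = 1 / N) (hgw' : ∀ k, μ.real (g' ⁻¹' {k}) = 1 / N)
    (x : Fin N → ℝ) (σ : Equiv.Perm (Fin N)) :
    IdentDistrib (stepLp μ hg x : Ω → ℝ) (stepLp μ hg' (x ∘ σ)) μ μ := by
  have hσ : Measurable (σ : Fin N → Fin N) := by fun_prop
  have hid : IdentDistrib g (σ ∘ g') μ μ := by
    refine ⟨hg.aemeasurable, (hσ.comp hg').aemeasurable, ?_⟩
    have := Measure.isProbabilityMeasure_map hg.aemeasurable (μ := μ)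
    have := Measure.isProbabilityMeasure_map (hσ.comp hg').aemeasurable (μ := μ)
    refine Measure.ext_of_singleton fun k => ?_
    rw [← measureReal_eq_measureReal_iff, map_measureReal_apply hg (measurableSet_singleton _),
      map_measureReal_apply (hσ.comp hg') (measurableSet_singleton _), hgw,
      Set.preimage_comp]
    have : (σ : Fin N → Fin N) ⁻¹' {k} = {σ.symm k} := by
      ext j; simp [Equiv.eq_symm_apply]
    rw [this, hgw']
  have hx : Measurable x := by fun_prop
  have h1 : IdentDistrib (stepLp μ hg x : Ω → ℝ) (x ∘ g) μ μ :=
    IdentDistrib.of_ae_eq (Lp.aestronglyMeasurable _).aemeasurable (coeFn_stepLp hg x)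
  have h2 : IdentDistrib (stepLp μ hg' (x ∘ σ) : Ω → ℝ) ((x ∘ σ) ∘ g') μ μ :=
    IdentDistrib.of_ae_eq (Lp.aestronglyMeasurable _).aemeasurable (coeFn_stepLp hg' _)
  exact (h1.trans (hid.comp hx)).trans h2.symm

/-- Monotonicity with respect to second order dominance, between bounds `X` and `Y` that stay above
a level that `X` attains with positive probability. -/
lemma le_of_integral_min_le (h : AtomlessMeasure μ) {U : Xinf μ → ℝ} (hmono : UMonotone U)
    (hconc : ConcaveOn ℝ Set.univ U) (htrans : TranslationInvariant U) (hlaw : LawInvariant U)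
    {X Y : Ω → ℝ} (hX : Measurable X) (hY : Measurable Y) {m M : ℝ} (hmM : m < M)
    (hXb : ∀ ω, m ≤ X ω ∧ X ω ≤ M) (hYb : ∀ ω, m ≤ Y ω ∧ Y ω ≤ M)
    (hp : 0 < μ.real {ω | X ω ≤ m})
    (hXY : ∀ t, ∫ ω, min (X ω) t ∂μ ≤ ∫ ω, min (Y ω) t ∂μ) {Z₁ Z₂ : Xinf μ}
    (h₁ : (Z₁ : Ω → ℝ) ≤ᵐ[μ] X) (h₂ : Y ≤ᵐ[μ] (Z₂ : Ω → ℝ)) : U Z₁ ≤ U Z₂ := by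
  refine le_of_forall_pos_le_add fun ε hε => ?_
  have hMm : 0 < M - m := sub_pos.2 hmM
  set δ := min ε (M - m)
  have hδ : 0 < δ := lt_min hε hMm
  set ρ := δ / (M - m) * μ.real {ω | X ω ≤ m}
  have hρ : 0 < ρ := mul_pos (div_pos hδ hMm) hp
  obtain ⟨N, hN⟩ := exists_nat_gt (2 / ρ)
  have hN0 : (0 : ℝ) < N := lt_trans (by positivity) hN
  have hN1 : 1 ≤ N := by exact_mod_cast hN0
  obtain ⟨g, q, hq⟩ := h.exists_isQuantileCut hX hmM.le hXb hN1
  obtain ⟨g', r, hr⟩ := h.exists_isQuantileCut hY hmM.le hYb hN1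
  have hmaj := fun t => sum_min_le_of_isQuantileCut hX hY hmM hXb hYb hδ (min_le_right _ _) hN1
    (by rw [div_le_iff₀ hN0, mul_comm]; exact ((div_lt_iff₀ hρ).1 hN).le) hq hr (hXY t)
  let a : Fin N → ℝ := fun k => q (k + 1)
  let b : Fin N → ℝ := fun k => r k
  have hZa : U Z₁ ≤ U (stepLp μ hq.measurable a) := by
    refine hmono _ _ ((Lp.coeFn_le _ _).1 ?_)
    filter_upwards [h₁, coeFn_stepLp hq.measurable a] with ω h1 h2
    rw [h2]
    exact h1.trans (hq.le ω).2
  have hbZ : U (stepLp μ hr.measurable b) ≤ U Z₂ := by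
    refine hmono _ _ ((Lp.coeFn_le _ _).1 ?_)
    filter_upwards [h₂, coeFn_stepLp hr.measurable b] with ω h1 h2
    rw [h2]
    exact (hr.le ω).1.trans h1
  have hab : U (stepLp μ hq.measurable a) ≤ U (stepLp μ hr.measurable fun k => b k + δ) :=
    (concaveOn_comp_stepLp hconc hr.measurable).le_of_sum_min_le
      (fun x y hxy => hmono _ _ (monotone_stepLp hr.measurable hxy))
      (fun σ => (hlaw _ _ (identDistrib_stepLp hq.measurable hr.measurable hq.measure hr.measure
        a σ)).le) hmaj
  rw [stepLp_add_const, htrans] at hab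
  linarith [min_le_left ε (M - m)]

set_option linter.unusedSectionVars false in
lemma ae_abs_le_norm (Z : Xinf μ) : ∀ᵐ ω ∂μ, |Z ω| ≤ ‖Z‖ := by
  have hfin := Lp.eLpNorm_ne_top Z
  filter_upwards [ae_le_eLpNormEssSup (f := (Z : Ω → ℝ)) (μ := μ)] with ω hω
  rw [← eLpNorm_exponent_top] at hω
  rw [Lp.norm_def, ← Real.norm_eq_abs, ← toReal_enorm]
  exact ENNReal.toReal_mono hfin hω

lemma exists_ae_ge_and_measureReal_pos (Z : Xinf μ) {ε : ℝ} (hε : 0 < ε) :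
    ∃ x : ℝ, (∀ᵐ ω ∂μ, x ≤ Z ω) ∧ 0 < μ.real {ω | Z ω ≤ x + ε} := by
  let T : Set ℝ := {x | ∀ᵐ ω ∂μ, x ≤ Z ω}
  have hne : T.Nonempty := ⟨-‖Z‖, by
    filter_upwards [ae_abs_le_norm Z] with ω hω using (abs_le.1 hω).1⟩
  have hbdd : BddAbove T := ⟨‖Z‖, fun x hx => by
    have hx' : ∀ᵐ ω ∂μ, x ≤ Z ω := hx
    obtain ⟨ω, h1, h2⟩ := (hx'.and (ae_abs_le_norm Z)).exists
    exact h1.trans (abs_le.1 h2).2⟩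
  obtain ⟨x, hx, hlt⟩ := exists_lt_of_lt_csSup hne (sub_lt_self (sSup T) hε)
  refine ⟨x, hx, measureReal_nonneg.lt_of_ne fun h0 => ?_⟩
  have h0' : μ {ω | Z ω ≤ x + ε} = 0 := (measureReal_eq_zero_iff (measure_ne_top _ _)).1 h0.symm
  have : x + ε ∈ T := by
    filter_upwards [measure_eq_zero_iff_ae_notMem.1 h0'] with ω hω
    exact (not_le.1 hω).le
  linarith [le_csSup hbdd this]

lemma LawInvariant.ssdPreserving (h : AtomlessMeasure μ) {U : Xinf μ → ℝ} (hmono : UMonotone U)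
    (hconc : ConcaveOn ℝ Set.univ U) (htrans : TranslationInvariant U) (hlaw : LawInvariant U) :
    SSDPreserving U := by
  intro Z₁ Z₂ hZ
  refine le_of_forall_pos_le_add fun ε hε => ?_
  rw [← htrans]
  obtain ⟨x, hx, hpos⟩ := exists_ae_ge_and_measureReal_pos Z₁ hε
  have hmin : ∀ t, ∫ ω, min (Z₁ ω) t ∂μ ≤ ∫ ω, min (Z₂ ω) t ∂μ := fun t =>
    hZ (fun y => min y t) (fun _ _ hy => min_le_min_right t hy)
      ((concaveOn_id convex_univ).inf (concaveOn_const t convex_univ))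
  have hi : ∀ Z : Xinf μ, Integrable (Z : Ω → ℝ) μ := fun Z => (Lp.memLp Z).integrable le_top
  have hm : ∀ Z : Xinf μ, Measurable (Z : Ω → ℝ) := fun Z => (Lp.stronglyMeasurable Z).measurable
  have hx₂ : ∀ᵐ ω ∂μ, x ≤ Z₂ ω := by
    have hle : (fun ω => min (Z₂ ω) x) ≤ᵐ[μ] fun _ => x := ae_of_all _ fun ω => min_le_right _ _
    have h1 : ∫ ω, min (Z₁ ω) x ∂μ = x := by
      rw [integral_congr_ae (g := fun _ => x) (hx.mono fun ω hω => min_eq_right hω)]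
      simp
    have h2 : ∫ ω, min (Z₂ ω) x ∂μ = ∫ _, x ∂μ :=
      le_antisymm (integral_mono_ae (integrable_min_const (hi _) _) (integrable_const _) hle)
        (by simpa [h1] using hmin x)
    have h3 := (integral_eq_iff_of_ae_le (integrable_min_const (hi _) _) (integrable_const _)
      hle).1 h2
    filter_upwards [h3] with ω hω
    exact min_eq_right_iff.1 hω
  set m := x + ε with hmdef
  set M := max m (max ‖Z₁‖ (‖Z₂‖ + ε)) + 1
  have hmM : m < M := (le_max_left _ _).trans_lt (lt_add_one _)
  have hM₁ : ‖Z₁‖ ≤ M := ((le_max_left _ _).trans (le_max_right _ _)).trans (lt_add_one _).le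
  have hM₂ : ‖Z₂‖ + ε ≤ M := ((le_max_right _ _).trans (le_max_right _ _)).trans (lt_add_one _).le
  let X : Ω → ℝ := fun ω => max m (min M (Z₁ ω))
  let Y : Ω → ℝ := fun ω => max m (min M (Z₂ ω + ε))
  have hXm : Measurable X := measurable_const.max (measurable_const.min (hm Z₁))
  have hYm : Measurable Y := measurable_const.max (measurable_const.min ((hm Z₂).add_const ε))
  have hXb : ∀ ω, m ≤ X ω ∧ X ω ≤ M := fun ω =>
    ⟨le_max_left _ _, max_le hmM.le (min_le_left _ _)⟩
  have hYb : ∀ ω, m ≤ Y ω ∧ Y ω ≤ M := fun ω =>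
    ⟨le_max_left _ _, max_le hmM.le (min_le_left _ _)⟩
  have hYeq : ∀ᵐ ω ∂μ, Y ω = Z₂ ω + ε := by
    filter_upwards [hx₂, ae_abs_le_norm Z₂] with ω h1 h2
    simp only [Y]
    rw [min_eq_right (by linarith [(abs_le.1 h2).2]), max_eq_right (by linarith)]
  have hshift : ∀ y t : ℝ, min (y + ε) t = min y (t - ε) + ε := fun y t => by
    rw [← min_add_add_right, sub_add_cancel]
  refine le_of_integral_min_le h hmono hconc htrans hlaw hXm hYm hmM hXb hYb ?_ (fun t => ?_) ?_ ?_
  · refine hpos.trans_le (measureReal_mono fun ω (hω : Z₁ ω ≤ m) => ?_)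
    exact max_le le_rfl ((min_le_right _ _).trans hω)
  · calc ∫ ω, min (X ω) t ∂μ ≤ ∫ ω, (min (Z₁ ω) (t - ε) + ε) ∂μ := by
          refine integral_mono_ae (integrable_min_const (Integrable.of_mem_Icc m M
            hXm.aemeasurable (ae_of_all μ fun ω => hXb ω)) t)
            ((integrable_min_const (hi _) _).add (integrable_const _)) ?_
          filter_upwards [hx] with ω hω
          rw [← hshift]
          refine min_le_min_right t (max_le (by linarith) ((min_le_right _ _).trans ?_))
          linarith
      _ ≤ ∫ ω, (min (Z₂ ω) (t - ε) + ε) ∂μ := by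
          rw [integral_add (integrable_min_const (hi _) _) (integrable_const _),
            integral_add (integrable_min_const (hi _) _) (integrable_const _)]
          exact add_le_add_left (hmin _) _
      _ = ∫ ω, min (Y ω) t ∂μ := by
          refine integral_congr_ae ?_
          filter_upwards [hYeq] with ω hω
          rw [hω, hshift]
  · filter_upwards [ae_abs_le_norm Z₁] with ω hω
    exact (le_min ((abs_le.1 hω).2.trans hM₁) le_rfl).trans (le_max_right _ _)
  · filter_upwards [hYeq, Lp.coeFn_add Z₂ (Lp.const ⊤ μ ε), Lp.coeFn_const (p := ⊤) (μ := μ) ε]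
      with ω h1 h2 h3
    rw [h1, h2, Pi.add_apply, h3]
    exact le_rfl

set_option linter.unusedSectionVars false in
lemma SSDPreserving.lawInvariant {U : Xinf μ → ℝ} (h : SSDPreserving U) : LawInvariant U := by
  have key : ∀ Z₁ Z₂ : Xinf μ, IdentDistrib (Z₁ : Ω → ℝ) (Z₂ : Ω → ℝ) μ μ → U Z₁ ≤ U Z₂ :=
    fun Z₁ Z₂ hid => h _ _ fun φ hφ _ => (hid.comp hφ.measurable).integral_eq.le
  exact fun Z₁ Z₂ hid => (key _ _ hid).antisymm (key _ _ hid.symm)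

/-- A monetary utility (monotone, concave, translation invariant) is S.S.D.
preserving if and only if it is law-invariant. -/
theorem monetary_ssdPreserving_iff_lawInvariant
    (hatomless : AtomlessMeasure μ) (U : Xinf μ → ℝ)
    (hmono : UMonotone U) (hconc : ConcaveOn ℝ Set.univ U)
    (htrans : TranslationInvariant U) :
    SSDPreserving U ↔ LawInvariant U :=
  ⟨SSDPreserving.lawInvariant, LawInvariant.ssdPreserving hatomless hmono hconc htrans⟩

end
end
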